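/- arXiv:1201.5071 — 5 statements merged into one kernel-verified Lean document; each statement's English description precedes it below -/
import Mathlib

section
/- Let M be a finite-dimensional complex left central Leibniz algebra with radical R, and let U ⊆ M be a totally isotropic two-sided ideal. Then U is a Lie subalgebra of M and [U,U] ⊆ R. -/
open Submodule

section LeibnizDefs

variable {M : Type*} [AddCommGroup M] [Module ℂ M]

/-- The left Leibniz identity for a bilinear bracket. -/
def IsLeftLeibniz (br : M →ₗ[ℂ] M →ₗ[ℂ] M) : Prop :=
  ∀ a b c : M, br a (br b c) = br (br a b) c + br b (br a c)

/-- The right Leibniz identity for a bilinear bracket. -/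
def IsRightLeibniz (br : M →ₗ[ℂ] M →ₗ[ℂ] M) : Prop :=
  ∀ a b c : M, br (br a b) c = br (br a c) b + br a (br b c)

/-- Left central: `[a,[b,b]] = 0` for all `a, b`. -/
def IsLeftCentral (br : M →ₗ[ℂ] M →ₗ[ℂ] M) : Prop :=
  ∀ a b : M, br a (br b b) = 0

/-- The Leibniz kernel `C(M)`, the span of all squares `[a,a]`. -/
def leibnizKernel (br : M →ₗ[ℂ] M →ₗ[ℂ] M) : Submodule ℂ M :=
  Submodule.span ℂ {x | ∃ a : M, br a a = x}

/-- A two-sided ideal of a Leibniz algebra. -/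
def IsTwoSidedIdeal (br : M →ₗ[ℂ] M →ₗ[ℂ] M) (U : Submodule ℂ M) : Prop :=
  ∀ m u : M, u ∈ U → br m u ∈ U ∧ br u m ∈ U

/-- A Lie subalgebra: a subspace closed under the bracket on which the bracket is alternating. -/
def IsLieSubalgebra (br : M →ₗ[ℂ] M →ₗ[ℂ] M) (L : Submodule ℂ M) : Prop :=
  (∀ a ∈ L, ∀ b ∈ L, br a b ∈ L) ∧ ∀ a ∈ L, br a a = 0

/-- The derived series of a subspace. -/
def leibDerivedSeries (br : M →ₗ[ℂ] M →ₗ[ℂ] M) (U : Submodule ℂ M) : ℕ → Submodule ℂ M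
  | 0 => U
  | n + 1 => Submodule.span ℂ
      {x | ∃ a ∈ leibDerivedSeries br U n, ∃ b ∈ leibDerivedSeries br U n, br a b = x}

/-- Solvability of a subspace. -/
def IsLeibnizSolvable (br : M →ₗ[ℂ] M →ₗ[ℂ] M) (U : Submodule ℂ M) : Prop :=
  ∃ n : ℕ, leibDerivedSeries br U n = ⊥

/-- `B` is the solvable radical: the largest solvable two-sided ideal. -/
def IsSolvableRadical (br : M →ₗ[ℂ] M →ₗ[ℂ] M) (B : Submodule ℂ M) : Prop :=
  IsTwoSidedIdeal br B ∧ IsLeibnizSolvable br B ∧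
    ∀ U : Submodule ℂ M, IsTwoSidedIdeal br U → IsLeibnizSolvable br U → U ≤ B

/-- Semisimplicity of a bracket-closed subspace `S` on which the bracket is a Lie bracket,
expressed via the standard characterization (valid for finite-dimensional complex Lie
algebras): `S` has no nonzero abelian ideal. -/
def IsSemisimpleSubalgebra (br : M →ₗ[ℂ] M →ₗ[ℂ] M) (S : Submodule ℂ M) : Prop :=
  ∀ A : Submodule ℂ M, A ≤ S →
    (∀ s ∈ S, ∀ a ∈ A, br s a ∈ A ∧ br a s ∈ A) →
    (∀ a ∈ A, ∀ b ∈ A, br a b = 0) → A = ⊥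

/-- The truncated exponential series of an endomorphism; if `f ^ n = 0` this is `exp f`. -/
noncomputable def expSum (f : Module.End ℂ M) (n : ℕ) : Module.End ℂ M :=
  ∑ i ∈ Finset.range n, ((i.factorial : ℂ)⁻¹) • f ^ i

/-- A subspace `A` with `R ≤ A` whose image in `M/R` is a (two-sided) ideal. -/
def IsIdealAbove (br : M →ₗ[ℂ] M →ₗ[ℂ] M) (R A : Submodule ℂ M) : Prop :=
  R ≤ A ∧ ∀ m a : M, a ∈ A → br m a ∈ A ∧ br a m ∈ A

/-- The derived series relative to `R` (computing the derived series of the image in `M/R`). -/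
def derivedSeriesMod (br : M →ₗ[ℂ] M →ₗ[ℂ] M) (R U : Submodule ℂ M) : ℕ → Submodule ℂ M
  | 0 => U ⊔ R
  | n + 1 => Submodule.span ℂ
      {x | ∃ a ∈ derivedSeriesMod br R U n, ∃ b ∈ derivedSeriesMod br R U n, br a b = x} ⊔ R

/-- Solvability of the image of `U` in `M/R`. -/
def IsSolvableMod (br : M →ₗ[ℂ] M →ₗ[ℂ] M) (R U : Submodule ℂ M) : Prop :=
  ∃ n : ℕ, derivedSeriesMod br R U n ≤ R

/-- `B/R` is the solvable radical of `M/R`. -/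
def IsSolvableRadicalMod (br : M →ₗ[ℂ] M →ₗ[ℂ] M) (R B : Submodule ℂ M) : Prop :=
  IsIdealAbove br R B ∧ IsSolvableMod br R B ∧
    ∀ U : Submodule ℂ M, IsIdealAbove br R U → IsSolvableMod br R U → U ≤ B

/-- Semisimplicity of `L/R` as a Lie algebra, expressed via the standard characterization:
no ideal of `L/R` strictly between `R` and `L` is abelian, except the zero one. -/
def IsSemisimpleMod (br : M →ₗ[ℂ] M →ₗ[ℂ] M) (R L : Submodule ℂ M) : Prop :=
  ∀ A : Submodule ℂ M, R ≤ A → A ≤ L →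
    (∀ l ∈ L, ∀ a ∈ A, br l a ∈ A ∧ br a l ∈ A) →
    (∀ a ∈ A, ∀ b ∈ A, br a b ∈ R) → A = R

/-- The lower central series of `L` relative to `R`. -/
def lowerCentralSeriesMod (br : M →ₗ[ℂ] M →ₗ[ℂ] M) (R L : Submodule ℂ M) :
    ℕ → Submodule ℂ M
  | 0 => L ⊔ R
  | n + 1 => Submodule.span ℂ
      {x | ∃ a ∈ L, ∃ b ∈ lowerCentralSeriesMod br R L n, br a b = x} ⊔ R

/-- Nilpotency of `L/R`. -/
def IsNilpotentMod (br : M →ₗ[ℂ] M →ₗ[ℂ] M) (R L : Submodule ℂ M) : Prop :=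
  ∃ n : ℕ, lowerCentralSeriesMod br R L n ≤ R

/-- A totally isotropic subspace for the pairing `ψ(a,b) = [a,b] + [b,a]`. -/
def IsTotallyIsotropic (br : M →ₗ[ℂ] M →ₗ[ℂ] M) (U : Submodule ℂ M) : Prop :=
  ∀ a ∈ U, ∀ b ∈ U, br a b + br b a = 0

end LeibnizDefs

/-- Polarized form of left centrality: left multiplications kill all values of `ψ`. -/
theorem IsLeftCentral.br_add_br {M : Type*} [AddCommGroup M] [Module ℂ M]
    {br : M →ₗ[ℂ] M →ₗ[ℂ] M} (hcent : IsLeftCentral br) (a b c : M) :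
    br a (br b c) + br a (br c b) = 0 := by
  have h := hcent a (b + c)
  simp only [map_add, LinearMap.add_apply, hcent a b, hcent a c, zero_add, add_zero] at h
  rwa [add_comm]

/-- Left multiplications are skew with respect to `ψ`. -/
theorem IsLeftCentral.pairing_skew {M : Type*} [AddCommGroup M] [Module ℂ M]
    {br : M →ₗ[ℂ] M →ₗ[ℂ] M} (hcent : IsLeftCentral br) (hleib : IsLeftLeibniz br)
    (a b c : M) :
    br (br a b) c + br c (br a b) + (br b (br a c) + br (br a c) b) = 0 := by
  have h := hcent.br_add_br a b c
  rw [hleib a b c, hleib a c b] at h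
  rw [← h]
  abel

/-- (Lemma 4.3)  A totally isotropic two-sided ideal `U` of a left central
Leibniz algebra is a Lie subalgebra with `[U,U] ⊆ R`. -/
theorem isotropic_ideal_derived_in_radical (M : Type*) [AddCommGroup M] [Module ℂ M]
    [FiniteDimensional ℂ M] (br : M →ₗ[ℂ] M →ₗ[ℂ] M) (hleib : IsLeftLeibniz br)
    (hcent : IsLeftCentral br)
    (R : Submodule ℂ M) (hR : ∀ x : M, x ∈ R ↔ ∀ a : M, br x a + br a x = 0)
    (U : Submodule ℂ M) (hUideal : IsTwoSidedIdeal br U)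
    (hUiso : IsTotallyIsotropic br U) :
    IsLieSubalgebra br U ∧ ∀ a ∈ U, ∀ b ∈ U, br a b ∈ R := by
  refine ⟨⟨fun a _ b hb => (hUideal a b hb).1, fun a ha => ?_⟩, fun a ha b hb => ?_⟩
  · have h := hUiso a ha a ha
    rw [← two_smul ℂ] at h
    exact (smul_eq_zero.mp h).resolve_left two_ne_zero
  · refine (hR _).2 fun m => ?_
    have h := hcent.pairing_skew hleib a b m
    rwa [hUiso b hb _ (hUideal m a ha).2, add_zero] at h
end

section
/- Let M be a finite-dimensional complex left central Leibniz algebra with radical R, and let L be a subspace with R ⊆ L ⊆ M such that L is closed under the bracket and the quotient L/R, as a Lie subalgebra of the Lie algebra M/R, is semisimple. Then L is a Lie subalgebra of M, i.e., [a,a] = 0 for all a ∈ L. -/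
open Submodule

attribute [local instance] LieRing.ofAssociativeRing

section Sl2

variable {W : Type*} [AddCommGroup W] [Module ℂ W] [FiniteDimensional ℂ W]
  {h e f : Module.End ℂ W}

lemma IsSl2Triple.eq_zero_of_eigenvalue_neg_two (t : IsSl2Triple h e f) {v : W}
    (hv : h v = (-2 : ℂ) • v) (hev : e (e v) = 0) : v = 0 := by
  have not_primitive : ∀ w : W, h w = (-2 : ℂ) • w → e w = 0 → w = 0 := by
    intro w hw hw'
    by_contra hne
    obtain ⟨n, hn⟩ := (IsSl2Triple.HasPrimitiveVectorWith.mk (t := t) hne hw hw').exists_nat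
    have : ((n + 2 : ℕ) : ℂ) = 0 := by push_cast; rw [← hn]; ring
    exact absurd this (Nat.cast_ne_zero.mpr (by omega))
  have hhe : h (e v) = 0 := by
    have := congr($(t.lie_h_e_smul ℂ) v)
    rwa [Ring.lie_def, LinearMap.sub_apply, Module.End.mul_apply, Module.End.mul_apply, hv,
      map_smul, LinearMap.smul_apply, neg_smul, sub_neg_eq_add, add_eq_right] at this
  have hfe : f (e v) = 0 := by
    by_contra hne
    have hu : e v ≠ 0 := fun h0 ↦ hne (by rw [h0, map_zero])
    have P : t.HasPrimitiveVectorWith (e v) (0 : ℂ) := ⟨hu, by simpa using hhe, hev⟩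
    exact hne (by simpa using P.pow_toEnd_f_eq_zero_of_eq_nat (n := 0) (by simp))
  have hfv : ∀ n : ℕ, h ((f ^ n) v) = (-2 - 2 * n : ℂ) • (f ^ n) v := by
    intro n
    have hv' : ⁅-h, v⁆ = (2 : ℂ) • v := by
      rw [neg_lie, Module.End.lie_apply, hv, neg_smul, neg_neg]
    have := t.symm.lie_h_pow_toEnd_e hv' n
    rw [neg_lie, neg_eq_iff_eq_neg, ← neg_smul] at this
    rwa [show (-2 - 2 * n : ℂ) = -(2 + 2 * n) by ring]
  have hefv : ∀ n : ℕ, e ((f ^ (n + 1)) v) = (-(n + 1) * (n + 2) : ℂ) • (f ^ n) v := by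
    have comm : ∀ w, e (f w) = h w + f (e w) := by
      intro w
      have := congr($(t.lie_e_f) w)
      rw [Ring.lie_def, LinearMap.sub_apply, Module.End.mul_apply, Module.End.mul_apply] at this
      rw [← this]; abel
    intro n
    induction n with
    | zero => simp [comm, hfe, hv]
    | succ n ih =>
      rw [pow_succ' f (n + 1), Module.End.mul_apply, comm, ih, map_smul, ← Module.End.mul_apply f,
        ← pow_succ', hfv, ← add_smul]
      congr 1
      push_cast
      ring
  by_contra hne
  have hall : ∀ n : ℕ, (f ^ n) v ≠ 0 := by
    intro n
    induction n with
    | zero => simpa using hne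
    | succ n ih =>
      intro h0
      have := hefv n
      rw [h0, map_zero, eq_comm, smul_eq_zero_iff_left ih] at this
      have h2 : (((n + 1) * (n + 2) : ℕ) : ℂ) = 0 := by push_cast; linear_combination -this
      exact absurd h2 (Nat.cast_ne_zero.mpr (by positivity))
  have hinj : Function.Injective fun n : ℕ ↦ (-2 - 2 * n : ℂ) := fun m n hmn ↦ by simpa using hmn
  have hinf : Set.Infinite {μ : ℂ | h.HasEigenvalue μ} :=
    (Set.infinite_range_of_injective hinj).mono <| by
      rintro _ ⟨n, rfl⟩
      exact Module.End.hasEigenvalue_of_hasEigenvector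
        (Module.End.hasEigenvector_iff.mpr ⟨Module.End.mem_eigenspace_iff.mpr (hfv n), hall n⟩)
  exact hinf (Module.End.finite_hasEigenvalue h)

lemma eq_zero_of_mem_maxGenEigenspace_neg_two (hef : ⁅e, f⁆ = h) (hhe : ⁅h, e⁆ = 2 • e)
    (hhf : ⁅h, f⁆ = -(2 • f)) {v : W} (hv : v ∈ h.maxGenEigenspace (-2)) (hev : e (e v) = 0) :
    v = 0 := by
  obtain ⟨k, hk⟩ := (Module.End.mem_maxGenEigenspace _ _ _).mp hv
  clear hv
  by_cases hh : h = 0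
  · subst hh
    have : ((0 : Module.End ℂ W) - (-2 : ℂ) • 1) = (2 : ℂ) • 1 := by simp
    rw [this, smul_pow, one_pow, LinearMap.smul_apply, Module.End.one_apply] at hk
    exact (smul_eq_zero_iff_right (pow_ne_zero _ two_ne_zero)).mp hk
  have t : IsSl2Triple h e f := ⟨hh, hef, hhe, hhf⟩
  induction k generalizing v with
  | zero => simpa using hk
  | succ k ih =>
    rw [pow_succ, Module.End.mul_apply] at hk
    have key : (h - (-2 : ℂ) • 1) v = 0 := by
      refine ih ?_ hk
      have comm : ∀ w, e (h w) = h (e w) - (2 : ℂ) • e w := by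
        intro w
        have := congr($(t.lie_h_e_smul ℂ) w)
        rw [Ring.lie_def, LinearMap.sub_apply, Module.End.mul_apply, Module.End.mul_apply,
          LinearMap.smul_apply] at this
        rw [← this]; abel
      simp [comm, hev]
    refine t.eq_zero_of_eigenvalue_neg_two ?_ hev
    rw [LinearMap.sub_apply, sub_eq_zero] at key
    simpa using key

end Sl2

section Filtered

lemma Module.End.map_mem_maxGenEigenspace {V W : Type*} [AddCommGroup V] [Module ℂ V]
    [AddCommGroup W] [Module ℂ W] {T : Module.End ℂ V} {T' : Module.End ℂ W} (g : V →ₗ[ℂ] W)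
    (hg : ∀ v, g (T v) = T' (g v)) {μ : ℂ} {v : V} (hv : v ∈ T.maxGenEigenspace μ) :
    g v ∈ T'.maxGenEigenspace μ := by
  rw [Module.End.mem_maxGenEigenspace] at hv ⊢
  obtain ⟨k, hk⟩ := hv
  refine ⟨k, ?_⟩
  have : (T' - μ • 1) ∘ₗ g = g ∘ₗ (T - μ • 1) := by
    ext w
    simp [hg]
  rw [← LinearMap.comp_apply, Module.End.commute_pow_left_of_commute this, LinearMap.comp_apply,
    hk, map_zero]

lemma Module.End.mem_maxGenEigenspace_of_injective {V W : Type*} [AddCommGroup V] [Module ℂ V]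
    [AddCommGroup W] [Module ℂ W] {T : Module.End ℂ V} {T' : Module.End ℂ W} (g : V →ₗ[ℂ] W)
    (hg : ∀ v, g (T v) = T' (g v)) (hinj : Function.Injective g) {μ : ℂ} {v : V}
    (hv : g v ∈ T'.maxGenEigenspace μ) : v ∈ T.maxGenEigenspace μ := by
  rw [Module.End.mem_maxGenEigenspace] at hv ⊢
  obtain ⟨k, hk⟩ := hv
  refine ⟨k, hinj ?_⟩
  have : (T' - μ • 1) ∘ₗ g = g ∘ₗ (T - μ • 1) := by
    ext w
    simp [hg]
  rw [map_zero, ← hk, ← LinearMap.comp_apply, ← Module.End.commute_pow_left_of_commute this,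
    LinearMap.comp_apply]

open LieModule

variable {L V : Type*} [LieRing L] [LieAlgebra ℂ L] [AddCommGroup V] [Module ℂ V]
  [LieRingModule L V] [LieModule ℂ L V] [FiniteDimensional ℂ V]

lemma eq_zero_of_lie_lie_eq_zero_of_trivial (r : LieIdeal ℂ L)
    (hr : ∀ x ∈ r, toEnd ℂ L V x = 0) {h e f : L} (hef : ⁅e, f⁆ - h ∈ r)
    (hhe : ⁅h, e⁆ - 2 • e ∈ r) (hhf : ⁅h, f⁆ + 2 • f ∈ r) {v : V}
    (hv : v ∈ (toEnd ℂ L V h).maxGenEigenspace (-2)) (hev : ⁅e, ⁅e, v⁆⁆ = 0) : v = 0 := by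
  have hr' : ∀ x y : L, x - y ∈ r → toEnd ℂ L V x = toEnd ℂ L V y := by
    intro x y hxy
    rw [← sub_eq_zero, ← map_sub, hr _ hxy]
  refine eq_zero_of_mem_maxGenEigenspace_neg_two (h := toEnd ℂ L V h) (e := toEnd ℂ L V e)
    (f := toEnd ℂ L V f) ?_ ?_ ?_ hv hev
  · rw [← LieHom.map_lie, hr' _ _ hef]
  · rw [← LieHom.map_lie, hr' _ _ hhe, map_nsmul]
  · rw [← LieHom.map_lie, hr' _ (-(2 • f)) (by rwa [sub_neg_eq_add]), map_neg, map_nsmul]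

lemma eq_zero_of_lie_lie_eq_zero (r : LieIdeal ℂ L)
    (hr : ∀ x ∈ r, IsNilpotent (toEnd ℂ L V x)) {h e f : L} (hef : ⁅e, f⁆ - h ∈ r)
    (hhe : ⁅h, e⁆ - 2 • e ∈ r) (hhf : ⁅h, f⁆ + 2 • f ∈ r) {v : V}
    (hv : v ∈ (toEnd ℂ L V h).maxGenEigenspace (-2)) (hev : ⁅e, ⁅e, v⁆⁆ = 0) : v = 0 := by
  have hnil : LieModule.IsNilpotent r V :=
    (LieModule.isNilpotent_iff_forall' (R := ℂ)).mpr fun x ↦ hr x x.2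
  obtain ⟨k, hk⟩ := (LieModule.isNilpotent_iff ℂ r V).mp hnil
  suffices ∀ n, v ∈ r.lcs V n by
    have := this k
    rwa [← LieSubmodule.mem_toSubmodule, LieIdeal.coe_lcs_eq, hk, LieSubmodule.bot_toSubmodule,
      Submodule.mem_bot] at this
  intro n
  induction n with
  | zero => simp
  | succ n ih =>
    let N := (r.lcs V (n + 1)).comap (r.lcs V n).incl
    let π := LieSubmodule.Quotient.mk' N
    have hπ : π ⟨v, ih⟩ = 0 := by
      refine eq_zero_of_lie_lie_eq_zero_of_trivial r ?_ hef hhe hhf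
        (Module.End.map_mem_maxGenEigenspace (T := toEnd ℂ L (r.lcs V n) h) π.toLinearMap
          (fun u ↦ π.map_lie h u) ?_) ?_
      · intro x hx
        ext p
        obtain ⟨u, rfl⟩ := LieSubmodule.Quotient.surjective_mk' N p
        rw [toEnd_apply_apply, ← LieModuleHom.map_lie, LinearMap.zero_apply]
        refine (LieSubmodule.Quotient.mk_eq_zero' (N := N)).mpr ?_
        rw [LieSubmodule.mem_comap, LieIdeal.lcs_succ]
        exact LieSubmodule.lie_mem_lie hx u.2
      · exact Module.End.mem_maxGenEigenspace_of_injective (T' := toEnd ℂ L V h)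
          (r.lcs V n).toSubmodule.subtype (fun _ ↦ rfl) (Submodule.injective_subtype _) hv
      · have : ⁅e, ⁅e, (⟨v, ih⟩ : r.lcs V n)⁆⁆ = 0 := Subtype.ext hev
        change ⁅e, ⁅e, π ⟨v, ih⟩⁆⁆ = 0
        rw [← LieModuleHom.map_lie, ← LieModuleHom.map_lie, this, map_zero]
    exact (LieSubmodule.Quotient.mk_eq_zero' (N := N)).mp hπ

end Filtered

lemma Module.End.exists_sub_mem_of_sub_smul_mem {V : Type*} [AddCommGroup V] [Module ℂ V]
    [FiniteDimensional ℂ V] (T : Module.End ℂ V) (μ : ℂ) {R : Submodule ℂ V}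
    (hR : ∀ v ∈ R, T v ∈ R) {x : V} (hx : T x - μ • x ∈ R) :
    ∃ y ∈ T.maxGenEigenspace μ, x - y ∈ R := by
  let D : Module.End ℂ V := T - μ • 1
  have hD : ∀ v ∈ R, D v ∈ R := fun v hv ↦ R.sub_mem (hR v hv) (R.smul_mem μ hv)
  let D' : Module.End ℂ R := D.restrict hD
  have htop := D'.isCompl_iSup_ker_pow_iInf_range_pow.codisjoint.eq_top
  obtain ⟨k, hk, i, hi, hki⟩ := Submodule.mem_sup.mp (htop ▸ Submodule.mem_top :
    (⟨D x, hx⟩ : R) ∈ (⨆ n, LinearMap.ker (D' ^ n)) ⊔ ⨅ n, LinearMap.range (D' ^ n))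
  obtain ⟨j, hj⟩ := (Submodule.mem_iInf _).mp hi 1
  rw [pow_one] at hj
  obtain ⟨n, hn⟩ := (Submodule.mem_iSup_of_directed _
    (D'.iterateKer.monotone.directed_le)).mp hk
  refine ⟨x - j, ?_, by simp⟩
  rw [Module.End.mem_maxGenEigenspace]
  refine ⟨n + 1, ?_⟩
  have h1 : D (x - j) = k := by
    have h2 := congr(($hki : V))
    have h3 := congr(($hj : V))
    rw [Submodule.coe_add] at h2
    rw [map_sub, sub_eq_iff_eq_add]
    rw [← h3] at h2
    exact h2.symm
  change (D ^ (n + 1)) (x - j) = 0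
  rw [pow_succ, Module.End.mul_apply, h1]
  have := congr(($hn : V))
  rwa [Module.End.pow_restrict n] at this

section Leibniz

variable {M : Type*} [AddCommGroup M] [Module ℂ M] {br : M →ₗ[ℂ] M →ₗ[ℂ] M}

lemma IsLeftLeibniz.apply_bracket (hleib : IsLeftLeibniz br) (a b : M) :
    br (br a b) = ⁅br a, br b⁆ := by
  ext c
  rw [Ring.lie_def, LinearMap.sub_apply, Module.End.mul_apply, Module.End.mul_apply, hleib a b c,
    add_sub_cancel_right]

/-- The image of a bracket-closed subspace under a representation, as a Lie algebra. -/
def imageLieSubalgebra {V : Type*} [AddCommGroup V] [Module ℂ V] (φ : M →ₗ[ℂ] Module.End ℂ V)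
    (hφ : ∀ a b, φ (br a b) = ⁅φ a, φ b⁆) (L : Submodule ℂ M)
    (hL : ∀ a ∈ L, ∀ b ∈ L, br a b ∈ L) : LieSubalgebra ℂ (Module.End ℂ V) where
  __ := L.map φ
  lie_mem' := by
    rintro _ _ ⟨a, ha, rfl⟩ ⟨b, hb, rfl⟩
    exact ⟨br a b, hL a ha b hb, hφ a b⟩

lemma IsLeftLeibniz.bracket_mem_maxGenEigenspace (hleib : IsLeftLeibniz br) {x a b : M} {μ ν : ℂ}
    (ha : a ∈ Module.End.maxGenEigenspace (br x) μ) (hb : b ∈ Module.End.maxGenEigenspace (br x) ν) :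
    br a b ∈ Module.End.maxGenEigenspace (br x) (μ + ν) :=
  LieModule.lie_mem_maxGenEigenspace_toEnd (R := ℂ) (L := Module.End ℂ M) (M := M) (x := br x)
    (Module.End.map_mem_maxGenEigenspace br (hleib.apply_bracket x) ha) hb

lemma bracket_self_eq_zero_of_sub_mem {R : Submodule ℂ M}
    (hR : ∀ x ∈ R, ∀ a, br x a + br a x = 0) {a b : M} (hab : a - b ∈ R) (hb : br b b = 0) :
    br a a = 0 := by
  obtain ⟨r, hr, rfl⟩ : ∃ r ∈ R, a = b + r := ⟨a - b, hab, by abel⟩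
  have h1 := hR r hr b
  have h2 : (2 : ℂ) • br r r = 0 := by rw [two_smul]; exact hR r hr r
  rw [smul_eq_zero_iff_right two_ne_zero] at h2
  simp only [map_add, LinearMap.add_apply, hb, h2, zero_add, add_zero]
  exact h1

variable [FiniteDimensional ℂ M]

lemma IsLeftLeibniz.eq_zero_of_bracket_bracket_eq_zero (hleib : IsLeftLeibniz br)
    {R : Submodule ℂ M} (hR : ∀ a, ∀ x ∈ R, br a x ∈ R) (hnil : ∀ x ∈ R, IsNilpotent (br x))
    {h e f : M} (hef : br e f - h ∈ R) (hhe : br h e - (2 : ℂ) • e ∈ R)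
    (hhf : br h f + (2 : ℂ) • f ∈ R) {v : M} (hv : v ∈ Module.End.maxGenEigenspace (br h) (-2))
    (hev : br e (br e v) = 0) : v = 0 := by
  let S := imageLieSubalgebra br hleib.apply_bracket ⊤ (by simp)
  let σ : M → S := fun x ↦ ⟨br x, x, trivial, rfl⟩
  let r : LieIdeal ℂ S :=
    { (R.map br).comap S.toSubmodule.subtype with
      lie_mem := by
        rintro ⟨_, a, -, rfl⟩ ⟨_, _⟩ ⟨x, hx, rfl⟩
        exact ⟨br a x, hR a x hx, hleib.apply_bracket a x⟩ }
  have hσ : ∀ x ∈ R, σ x ∈ r := fun x hx ↦ ⟨x, hx, rfl⟩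
  refine eq_zero_of_lie_lie_eq_zero (V := M) r ?_ (h := σ h) (e := σ e) (f := σ f) ?_ ?_ ?_ hv hev
  · rintro ⟨_, _⟩ ⟨x, hx, rfl⟩
    exact hnil x hx
  · convert hσ _ hef
    ext1
    simp [σ, hleib.apply_bracket]
  · convert hσ _ hhe
    ext1
    simp [σ, hleib.apply_bracket, two_smul]
  · convert hσ _ hhf
    ext1
    simp [σ, hleib.apply_bracket, two_smul]

end Leibniz

section SkewIdeal

lemma Module.End.exists_apply_eq_of_injOn {V : Type*} [AddCommGroup V] [Module ℂ V]
    [FiniteDimensional ℂ V] {T U : Module.End ℂ V} {A B : Submodule ℂ V}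
    (hT : ∀ v ∈ A, T v ∈ B) (hU : ∀ v ∈ B, U v ∈ A) (hT0 : ∀ v ∈ A, T v = 0 → v = 0)
    (hU0 : ∀ v ∈ B, U v = 0 → v = 0) {b : V} (hb : b ∈ B) : ∃ a ∈ A, T a = b := by
  let T' : A →ₗ[ℂ] B := T.restrict hT
  let U' : B →ₗ[ℂ] A := U.restrict hU
  have hT' : Function.Injective T' := (injective_iff_map_eq_zero T').mpr
    fun v hv ↦ Subtype.ext (hT0 v v.2 congr(($hv : V)))
  have hU' : Function.Injective U' := (injective_iff_map_eq_zero U').mpr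
    fun v hv ↦ Subtype.ext (hU0 v v.2 congr(($hv : V)))
  have hdim := le_antisymm (LinearMap.finrank_le_finrank_of_injective hT')
    (LinearMap.finrank_le_finrank_of_injective hU')
  obtain ⟨a, ha⟩ := (LinearMap.injective_iff_surjective_of_finrank_eq_finrank hdim).mp hT' ⟨b, hb⟩
  exact ⟨a, a.2, congr(($ha : V))⟩

variable {M : Type*} [AddCommGroup M] [Module ℂ M]

/-- An ideal which is contained in the radical and contains the Leibniz kernel. -/
structure IsSkewIdeal (br : M →ₗ[ℂ] M →ₗ[ℂ] M) (R : Submodule ℂ M) : Prop where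
  left_mem : ∀ a, ∀ x ∈ R, br a x ∈ R
  skew : ∀ x ∈ R, ∀ a, br x a + br a x = 0
  add_mem : ∀ a b, br a b + br b a ∈ R

/-- The `sl₂` relations modulo a subspace. -/
structure IsSl2TripleMod (br : M →ₗ[ℂ] M →ₗ[ℂ] M) (R : Submodule ℂ M) (h e f : M) : Prop where
  e_f : br e f - h ∈ R
  h_e : br h e - (2 : ℂ) • e ∈ R
  h_f : br h f + (2 : ℂ) • f ∈ R

variable {br : M →ₗ[ℂ] M →ₗ[ℂ] M} {R : Submodule ℂ M}

namespace IsSkewIdeal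

lemma right_mem (hR : IsSkewIdeal br R) {x : M} (hx : x ∈ R) (a : M) : br x a ∈ R := by
  rw [eq_neg_of_add_eq_zero_left (hR.skew x hx a)]
  exact R.neg_mem (hR.left_mem a x hx)

lemma sub_mem (hR : IsSkewIdeal br R) {a a' b b' : M} (ha : a - a' ∈ R) (hb : b - b' ∈ R) :
    br a b - br a' b' ∈ R := by
  have := R.add_mem (hR.right_mem ha b) (hR.left_mem a' _ hb)
  rwa [map_sub, map_sub, LinearMap.sub_apply, sub_add_sub_cancel] at this

end IsSkewIdeal

namespace IsSl2TripleMod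

variable {h e f h' e' f' : M}

lemma congr (t : IsSl2TripleMod br R h e f) (hR : IsSkewIdeal br R) (hh : h - h' ∈ R)
    (he : e - e' ∈ R) (hf : f - f' ∈ R) : IsSl2TripleMod br R h' e' f' where
  e_f := by
    convert R.add_mem (R.sub_mem t.e_f (hR.sub_mem he hf)) hh using 1
    abel
  h_e := by
    convert R.add_mem (R.sub_mem t.h_e (hR.sub_mem hh he)) (R.smul_mem (2 : ℂ) he) using 1
    module
  h_f := by
    convert R.sub_mem (R.sub_mem t.h_f (hR.sub_mem hh hf)) (R.smul_mem (2 : ℂ) hf) using 1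
    module

lemma symm (t : IsSl2TripleMod br R h e f) (hR : IsSkewIdeal br R) :
    IsSl2TripleMod br R (-h) f e where
  e_f := by
    convert R.sub_mem (hR.add_mem e f) t.e_f using 1
    abel
  h_e := by
    convert R.neg_mem t.h_f using 1
    simp only [map_neg, LinearMap.neg_apply]
    module
  h_f := by
    convert R.neg_mem t.h_e using 1
    simp only [map_neg, LinearMap.neg_apply]
    module

lemma eq_zero_of_bracket_bracket_eq_zero [FiniteDimensional ℂ M] (t : IsSl2TripleMod br R h e f)
    (hleib : IsLeftLeibniz br) (hR : IsSkewIdeal br R) (hnil : ∀ x ∈ R, IsNilpotent (br x))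
    {v : M} (hv : v ∈ Module.End.maxGenEigenspace (br h) (-2)) (hev : br e (br e v) = 0) : v = 0 :=
  hleib.eq_zero_of_bracket_bracket_eq_zero hR.left_mem hnil t.e_f t.h_e t.h_f hv hev

lemma eq_zero_of_bracket_bracket_eq_zero' [FiniteDimensional ℂ M]
    (t : IsSl2TripleMod br R h e f)
    (hleib : IsLeftLeibniz br) (hR : IsSkewIdeal br R) (hnil : ∀ x ∈ R, IsNilpotent (br x))
    {v : M} (hv : v ∈ Module.End.maxGenEigenspace (br h) 2) (hfv : br f (br f v) = 0) : v = 0 := by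
  refine (t.symm hR).eq_zero_of_bracket_bracket_eq_zero hleib hR hnil ?_ hfv
  rw [Module.End.mem_maxGenEigenspace] at hv ⊢
  obtain ⟨k, hk⟩ := hv
  refine ⟨k, ?_⟩
  have : br (-h) - (-2 : ℂ) • 1 = -((br h : Module.End ℂ M) - (2 : ℂ) • 1) := by
    rw [map_neg]
    module
  rw [this]
  rw [neg_pow, Module.End.mul_apply, hk, map_zero]

variable [FiniteDimensional ℂ M]

/-- If the ideal acts nilpotently, the neutral element of an `sl₂`-triple can be corrected to one
whose square vanishes. -/
lemma bracket_self_eq_zero_of_isNilpotent (t : IsSl2TripleMod br R h e f)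
    (hleib : IsLeftLeibniz br) (hcent : IsLeftCentral br) (hR : IsSkewIdeal br R)
    (hnil : ∀ x ∈ R, IsNilpotent (br x)) : br h h = 0 := by
  have mem : ∀ {a b : M} {μ ν : ℂ} (ρ : ℂ), a ∈ Module.End.maxGenEigenspace (br h) μ →
      b ∈ Module.End.maxGenEigenspace (br h) ν → μ + ν = ρ →
      br a b ∈ Module.End.maxGenEigenspace (br h) ρ := by
    rintro a b μ ν _ ha hb rfl
    exact hleib.bracket_mem_maxGenEigenspace ha hb
  obtain ⟨E, hE, heE⟩ :=
    Module.End.exists_sub_mem_of_sub_smul_mem (br h) 2 (hR.left_mem h) t.h_e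
  obtain ⟨F, hF, hfF⟩ := Module.End.exists_sub_mem_of_sub_smul_mem (br h) (-2) (hR.left_mem h)
    (x := f) (by rw [neg_smul, sub_neg_eq_add]; exact t.h_f)
  have t' : IsSl2TripleMod br R h E F := t.congr hR (by simp) heE hfF
  have hEEF : -(2 : ℂ) • E - br E (br E F) ∈ R := by
    have h1 := hR.left_mem E _ t'.e_f
    have h2 := hR.add_mem h E
    rw [map_sub] at h1
    convert R.sub_mem (R.sub_mem t'.h_e h2) h1 using 1
    module
  obtain ⟨w, hw, hEw⟩ : ∃ w ∈ R ⊓ Module.End.maxGenEigenspace (br h) (-2),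
      ((br E : Module.End ℂ M) ∘ₗ br E) w = -(2 : ℂ) • E - br E (br E F) := by
    refine Module.End.exists_apply_eq_of_injOn (U := (br F : Module.End ℂ M) ∘ₗ br F)
      (B := R ⊓ Module.End.maxGenEigenspace (br h) 2) ?_ ?_ ?_ ?_ ?_
    · exact fun v hv ↦ ⟨hR.left_mem _ _ (hR.left_mem _ _ hv.1),
        mem 2 hE (mem 0 hE hv.2 (by norm_num)) (by norm_num)⟩
    · exact fun v hv ↦ ⟨hR.left_mem _ _ (hR.left_mem _ _ hv.1),
        mem (-2) hF (mem 0 hF hv.2 (by norm_num)) (by norm_num)⟩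
    · exact fun v hv h0 ↦ t'.eq_zero_of_bracket_bracket_eq_zero hleib hR hnil hv.2 h0
    · exact fun v hv h0 ↦ t'.eq_zero_of_bracket_bracket_eq_zero' hleib hR hnil hv.2 h0
    · exact ⟨hEEF, Submodule.sub_mem _ (Submodule.smul_mem _ _ hE)
        (mem 2 hE (mem 0 hE hF (by norm_num)) (by norm_num))⟩
  rw [LinearMap.comp_apply] at hEw
  have hFw : F + w ∈ Module.End.maxGenEigenspace (br h) (-2) := Submodule.add_mem _ hF hw.2
  have hEh : br E (br E (F + w)) = -(2 : ℂ) • E := by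
    rw [map_add, map_add, hEw, add_sub_cancel]
  have hh : h - br E (F + w) ∈ R := by
    rw [map_add]
    convert R.neg_mem (R.add_mem t'.e_f (hR.left_mem E _ hw.1)) using 1
    abel
  refine bracket_self_eq_zero_of_sub_mem hR.skew hh ?_
  set h' := br E (F + w) with hh'
  have hw' : br E (br h' (F + w) + (2 : ℂ) • (F + w)) = br h' h' := by
    rw [map_add, map_smul, hleib E, hEh, ← hh', map_smul, LinearMap.smul_apply, ← hh', neg_smul]
    abel
  have h0 : br h' (F + w) + (2 : ℂ) • (F + w) = 0 := by
    refine t'.eq_zero_of_bracket_bracket_eq_zero hleib hR hnil ?_ (by rw [hw', hcent])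
    exact Submodule.add_mem _ (mem (-2) (mem 0 hE hFw (by norm_num)) hFw (by norm_num))
      (Submodule.smul_mem _ _ hFw)
  rw [← hw', h0, map_zero]

end IsSl2TripleMod

/-- The restriction of a bracket to a bracket-closed subspace. -/
def restrictBracket (br : M →ₗ[ℂ] M →ₗ[ℂ] M) (N : Submodule ℂ M)
    (hN : ∀ a ∈ N, ∀ b ∈ N, br a b ∈ N) : N →ₗ[ℂ] N →ₗ[ℂ] N :=
  LinearMap.mk₂ ℂ (fun a b ↦ ⟨br a b, hN a a.2 b b.2⟩) (by intros; ext; simp)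
    (by intros; ext; simp) (by intros; ext; simp) (by intros; ext; simp)

end SkewIdeal

lemma IsSl2TripleMod.bracket_self_eq_zero {M : Type*} [AddCommGroup M] [Module ℂ M]
    [FiniteDimensional ℂ M] {br : M →ₗ[ℂ] M →ₗ[ℂ] M} {R : Submodule ℂ M} {h e f : M}
    (t : IsSl2TripleMod br R h e f) (hleib : IsLeftLeibniz br) (hcent : IsLeftCentral br)
    (hR : IsSkewIdeal br R) : br h h = 0 := by
  induction hn : Module.finrank ℂ M using Nat.strong_induction_on generalizing M with
  | _ n ih =>
  by_cases hnil : ∀ x ∈ R, IsNilpotent (br x)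
  · exact t.bracket_self_eq_zero_of_isNilpotent hleib hcent hR hnil
  push Not at hnil
  obtain ⟨x, hx, hxnil⟩ := hnil
  let N := Module.End.maxGenEigenspace (br x) 0
  have hN : ∀ a ∈ N, ∀ b ∈ N, br a b ∈ N := fun a ha b hb ↦ by
    have := hleib.bracket_mem_maxGenEigenspace ha hb
    rwa [add_zero] at this
  have hlt : Module.finrank ℂ N < n := by
    rw [← hn]
    refine Submodule.finrank_lt fun htop ↦ hxnil ?_
    rw [Module.End.isNilpotent_iff_of_finite]
    intro m
    simpa using (Module.End.mem_maxGenEigenspace _ _ _).mp (htop ▸ Submodule.mem_top : m ∈ N)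
  have hlift : ∀ a : M, ∃ b ∈ N, a - b ∈ R := fun a ↦
    Module.End.exists_sub_mem_of_sub_smul_mem (br x) 0 (hR.left_mem x)
      (by rw [zero_smul, sub_zero]; exact hR.right_mem hx a)
  obtain ⟨h', hh'N, hh'⟩ := hlift h
  obtain ⟨e', he'N, he'⟩ := hlift e
  obtain ⟨f', hf'N, hf'⟩ := hlift f
  have t' := t.congr hR hh' he' hf'
  refine bracket_self_eq_zero_of_sub_mem hR.skew hh' ?_
  exact congr(($(ih _ hlt (br := restrictBracket br N hN) (R := R.comap N.subtype)
    (h := ⟨h', hh'N⟩) (e := ⟨e', he'N⟩) (f := ⟨f', hf'N⟩)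
    ⟨t'.e_f, t'.h_e, t'.h_f⟩ (fun a b c ↦ Subtype.ext (hleib a b c))
    (fun a b ↦ Subtype.ext (hcent a b))
    ⟨fun a y hy ↦ hR.left_mem a y hy, fun y hy a ↦ Subtype.ext (hR.skew y hy a),
      fun a b ↦ hR.add_mem a b⟩ rfl) : M))

section InvariantForm

open LieAlgebra LieAlgebra.IsKilling

variable {S : Type*} [LieRing S] [LieAlgebra ℂ S] [FiniteDimensional ℂ S]

lemma LieAlgebra.eq_top_of_cartan_le_of_rootSpace_le (H : LieSubalgebra ℂ S)
    [H.IsCartanSubalgebra] {p : Submodule ℂ S} (hH : ∀ y ∈ H, y ∈ p)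
    (hroot : ∀ α : LieModule.Weight ℂ H S, α.IsNonZero → ∀ y ∈ rootSpace H α, y ∈ p) : p = ⊤ := by
  have := congr(($(cartan_sup_iSup_rootSpace_eq_top (H := H))).toSubmodule)
  rw [eq_top_iff, ← LieSubmodule.top_toSubmodule (R := ℂ) (L := H) (M := S), ← this]
  simp only [LieSubmodule.sup_toSubmodule, LieSubmodule.iSup_toSubmodule]
  exact sup_le hH (iSup₂_le hroot)

/-- An invariant form is zero if it vanishes on the neutral elements of all
`sl₂`-triples. -/
lemma LieAlgebra.IsKilling.eq_zero_of_isSl2Triple [IsKilling ℂ S] {W : Type*} [AddCommGroup W]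
    [Module ℂ W] (g : S →ₗ[ℂ] S →ₗ[ℂ] W)
    (hinv : ∀ a b c : S, g ⁅a, b⁆ c = -g b ⁅a, c⁆)
    (hg : ∀ h e f, IsSl2Triple h e f → g h h = 0) : g = 0 := by
  obtain ⟨x, hx⟩ := exists_isCartanSubalgebra_engel ℂ S
  let H := LieSubalgebra.engel ℂ x
  have hcoroot : ∀ α : LieModule.Weight ℂ H S, α.IsNonZero →
      (coroot α : S) ∈ LinearMap.ker g := by
    intro α hα
    obtain ⟨h, e, f, t, he, hf⟩ := exists_isSl2Triple_of_weight_isNonZero hα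
    have hh := t.h_eq_coroot hα he hf
    have hy : ∀ y : H, g (coroot α) y = α y • g f e := by
      intro y
      have := lie_eq_smul_of_mem_rootSpace he y
      rw [LieSubalgebra.coe_bracket_of_module] at this
      rw [← hh, ← t.lie_e_f, hinv, ← lie_skew, this, map_neg, neg_neg, map_smul]
    have hfe : g f e = 0 := by
      have := hy (coroot α)
      rw [← hh, hg h e f t, root_apply_coroot hα] at this
      exact (smul_eq_zero_iff_right two_ne_zero).mp this.symm
    rw [LinearMap.mem_ker, ← LinearMap.ker_eq_top]
    refine eq_top_of_cartan_le_of_rootSpace_le H (fun y hyH ↦ ?_) fun β hβ y hyβ ↦ ?_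
    · rw [LinearMap.mem_ker, hy ⟨y, hyH⟩, hfe, smul_zero]
    · obtain ⟨k, hk⟩ := Function.ne_iff.mp hβ
      have h1 := lie_eq_smul_of_mem_rootSpace hyβ k
      have h2 := hinv k (coroot α) y
      rw [← LieSubalgebra.coe_bracket, trivial_lie_zero, ZeroMemClass.coe_zero, map_zero,
        LinearMap.zero_apply, ← LieSubalgebra.coe_bracket_of_module, h1, map_smul,
        eq_comm, neg_eq_zero] at h2
      exact (smul_eq_zero.mp h2).resolve_left hk
  rw [← LinearMap.ker_eq_top]
  refine eq_top_of_cartan_le_of_rootSpace_le H (fun y hy ↦ ?_) fun α hα y hy ↦ ?_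
  · have hle : Submodule.span ℂ (Set.range (rootSystem H).coroot) ≤
        (LinearMap.ker g).comap H.toSubmodule.subtype := by
      rw [Submodule.span_le]
      rintro _ ⟨α, rfl⟩
      exact hcoroot α (Finset.mem_filter.mp α.2).2
    rw [RootPairing.IsRootSystem.span_coroot_eq_top] at hle
    exact hle (Submodule.mem_top (x := ⟨y, hy⟩))
  · have h1 := lie_eq_smul_of_mem_rootSpace hy (coroot α)
    rw [LieSubalgebra.coe_bracket_of_module, root_apply_coroot hα] at h1
    have h2 : g ⁅(coroot α : S), y⁆ = 0 := by
      ext c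
      rw [← lie_skew, map_neg, LinearMap.neg_apply, hinv, neg_neg, hcoroot α hα]
      rfl
    rw [h1, map_smul] at h2
    exact (smul_eq_zero_iff_right two_ne_zero).mp h2

end InvariantForm

section QuotientAction

variable {M : Type*} [AddCommGroup M] [Module ℂ M] {br : M →ₗ[ℂ] M →ₗ[ℂ] M}
  {R : Submodule ℂ M}

lemma IsLeftCentral.bracket_add_eq_zero (hcent : IsLeftCentral br) (c a b : M) :
    br c (br a b + br b a) = 0 := by
  have := hcent c (a + b)
  simpa [hcent c a, hcent c b, add_comm] using this

lemma IsLeftLeibniz.bracket_add_eq_zero (hleib : IsLeftLeibniz br) (a b c : M) :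
    br (br a b + br b a) c = 0 := by
  rw [map_add, hleib.apply_bracket, hleib.apply_bracket, ← lie_skew, neg_add_cancel,
    LinearMap.zero_apply]

/-- Invariance of the symmetrised bracket under left multiplications. -/
lemma IsLeftLeibniz.add_bracket_eq_neg (hleib : IsLeftLeibniz br) (hcent : IsLeftCentral br)
    (a b c : M) :
    br (br a b) c + br c (br a b) = -(br b (br a c) + br (br a c) b) := by
  have := hcent.bracket_add_eq_zero a b c
  rw [map_add, hleib a b c, hleib a c b] at this
  rw [eq_neg_iff_add_eq_zero, ← this]
  abel

lemma IsSkewIdeal.of_forall_mem_iff (hleib : IsLeftLeibniz br) (hcent : IsLeftCentral br)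
    (hR : ∀ x, x ∈ R ↔ ∀ a, br x a + br a x = 0) : IsSkewIdeal br R where
  left_mem a x hx := (hR _).mpr fun c ↦ by
    rw [hleib.add_bracket_eq_neg hcent, (hR x).mp hx, neg_zero]
  skew x hx := (hR x).mp hx
  add_mem a b := (hR _).mpr fun c ↦ by
    rw [hleib.bracket_add_eq_zero, hcent.bracket_add_eq_zero, add_zero]

/-- The action of a Leibniz algebra on its quotient by an ideal. -/
def quotientAction (hR : IsSkewIdeal br R) : M →ₗ[ℂ] Module.End ℂ (M ⧸ R) where
  toFun x := R.mapQ R (br x) (hR.left_mem x)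
  map_add' x y := by ext; simp
  map_smul' c x := by ext; simp

lemma quotientAction_bracket (hleib : IsLeftLeibniz br) (hR : IsSkewIdeal br R) (a b : M) :
    quotientAction hR (br a b) = ⁅quotientAction hR a, quotientAction hR b⁆ := by
  ext c
  simp [quotientAction, Ring.lie_def, hleib.apply_bracket]

lemma bracket_mem_of_quotientAction_eq_zero {hR : IsSkewIdeal br R} {x : M}
    (hx : quotientAction hR x = 0) (a : M) : br x a ∈ R :=
  (Submodule.Quotient.mk_eq_zero R).mp congr($hx (Submodule.Quotient.mk a))

lemma quotientAction_eq_zero (hR : IsSkewIdeal br R) {x : M} (hx : x ∈ R) :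
    quotientAction hR x = 0 := by
  ext a
  exact (Submodule.Quotient.mk_eq_zero R).mpr (hR.right_mem hx a)

lemma mem_of_quotientAction_eq_zero {hR : IsSkewIdeal br R} (hleib : IsLeftLeibniz br)
    {L : Submodule ℂ M} (hRL : R ≤ L) (hL : ∀ a ∈ L, ∀ b ∈ L, br a b ∈ L)
    (hss : IsSemisimpleMod br R L) {x : M} (hxL : x ∈ L) (hx : quotientAction hR x = 0) :
    x ∈ R := by
  have := hss (L ⊓ LinearMap.ker (quotientAction hR))
    (fun r hr ↦ ⟨hRL hr, quotientAction_eq_zero hR hr⟩) inf_le_left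
    (fun l hl a ha ↦ ⟨⟨hL l hl a ha.1, ?_⟩, ⟨hL a ha.1 l hl, ?_⟩⟩)
    (fun a ha b _ ↦ bracket_mem_of_quotientAction_eq_zero ha.2 b)
  · exact this ▸ ⟨hxL, hx⟩
  · rw [SetLike.mem_coe, LinearMap.mem_ker, quotientAction_bracket hleib,
      LinearMap.mem_ker.mp ha.2, lie_zero]
  · rw [SetLike.mem_coe, LinearMap.mem_ker, quotientAction_bracket hleib,
      LinearMap.mem_ker.mp ha.2, zero_lie]

lemma hasTrivialRadical_imageLieSubalgebra [FiniteDimensional ℂ M] (hR : IsSkewIdeal br R)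
    (hleib : IsLeftLeibniz br)
    {L : Submodule ℂ M} (hRL : R ≤ L) (hL : ∀ a ∈ L, ∀ b ∈ L, br a b ∈ L)
    (hss : IsSemisimpleMod br R L) : LieAlgebra.HasTrivialRadical ℂ
      (imageLieSubalgebra (quotientAction hR) (quotientAction_bracket hleib hR) L hL) := by
  set S := imageLieSubalgebra (quotientAction hR) (quotientAction_bracket hleib hR) L hL
  rw [LieAlgebra.hasTrivialRadical_iff_no_abelian_ideals]
  intro I hI
  have hS : ∀ a ∈ L, quotientAction hR a ∈ S := fun a ha ↦ ⟨a, ha, rfl⟩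
  let A := L ⊓ (I.toSubmodule.map S.toSubmodule.subtype).comap (quotientAction hR)
  have hA : A = R := by
    refine hss A (fun r hr ↦ ⟨hRL hr, ?_⟩) inf_le_left ?_ ?_
    · rw [SetLike.mem_coe, Submodule.mem_comap, quotientAction_eq_zero hR hr]
      exact Submodule.zero_mem _
    · rintro l hl a ⟨ha, (y : S), hy, hya : (y : Module.End ℂ (M ⧸ R)) = _⟩
      refine ⟨⟨hL l hl a ha, ⁅(⟨_, hS l hl⟩ : S), y⁆, I.lie_mem hy, ?_⟩,
        ⟨hL a ha l hl, ⁅y, (⟨_, hS l hl⟩ : S)⁆, lie_mem_left ℂ _ I _ _ hy, ?_⟩⟩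
      · rw [quotientAction_bracket hleib, ← hya]
        rfl
      · rw [quotientAction_bracket hleib, ← hya]
        rfl
    · rintro a ⟨ha, (y : S), hy, hya : (y : Module.End ℂ (M ⧸ R)) = _⟩ b
        ⟨hb, (z : S), hz, hzb : (z : Module.End ℂ (M ⧸ R)) = _⟩
      refine mem_of_quotientAction_eq_zero (hR := hR) hleib hRL hL hss (hL a ha b hb) ?_
      rw [quotientAction_bracket hleib, ← hya, ← hzb]
      exact congr((($(hI.trivial ⟨y, hy⟩ ⟨z, hz⟩) : I) : S).1)
  rw [eq_bot_iff]
  rintro ⟨_, a, ha, rfl⟩ hy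
  have ha' : a ∈ A := ⟨ha, _, hy, rfl⟩
  rw [hA] at ha'
  exact Subtype.ext (quotientAction_eq_zero hR ha')

end QuotientAction

/-- (Lemma 4.4)  If `R ⊆ L ⊆ M`, `L` is closed under the bracket and
`L/R` is a semisimple Lie subalgebra of `M/R`, then `L` is a Lie subalgebra of `M`. -/
theorem semisimple_mod_radical_is_lie (M : Type*) [AddCommGroup M] [Module ℂ M]
    [FiniteDimensional ℂ M] (br : M →ₗ[ℂ] M →ₗ[ℂ] M) (hleib : IsLeftLeibniz br)
    (hcent : IsLeftCentral br)
    (R : Submodule ℂ M) (hR : ∀ x : M, x ∈ R ↔ ∀ a : M, br x a + br a x = 0)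
    (L : Submodule ℂ M) (hRL : R ≤ L)
    (hLclosed : ∀ a ∈ L, ∀ b ∈ L, br a b ∈ L)
    (hss : IsSemisimpleMod br R L) :
    ∀ a ∈ L, br a a = 0 := by
  have hskew : IsSkewIdeal br R := .of_forall_mem_iff hleib hcent hR
  let σ := quotientAction hskew
  let S := imageLieSubalgebra σ (quotientAction_bracket hleib hskew) L hLclosed
  have : LieAlgebra.HasTrivialRadical ℂ S :=
    hasTrivialRadical_imageLieSubalgebra hskew hleib hRL hLclosed hss
  have hsub : ∀ a ∈ L, ∀ b ∈ L, σ a = σ b → a - b ∈ R := fun a ha b hb hab ↦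
    mem_of_quotientAction_eq_zero (hR := hskew) hleib hRL hLclosed hss (L.sub_mem ha hb)
      (by rw [map_sub]; exact sub_eq_zero.mpr hab)
  let π : L →ₗ[ℂ] S := σ.restrict fun a ha ↦ ⟨a, ha, rfl⟩
  obtain ⟨s, hs⟩ := π.exists_rightInverse_of_surjective <| LinearMap.range_eq_top.mpr <| by
    rintro ⟨_, a, ha, rfl⟩
    exact ⟨⟨a, ha⟩, rfl⟩
  let t : S →ₗ[ℂ] M := L.subtype ∘ₗ s
  have htL : ∀ x, t x ∈ L := fun x ↦ (s x).2
  have hσt : ∀ x : S, σ (t x) = x := fun x ↦ congr((($hs x : S) : Module.End ℂ (M ⧸ R)))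
  have ht_lie : ∀ x y, br (t x) (t y) - t ⁅x, y⁆ ∈ R := fun x y ↦
    hsub _ (hLclosed _ (htL x) _ (htL y)) _ (htL _) <| by
      rw [hσt, quotientAction_bracket hleib, hσt, hσt, LieSubalgebra.coe_bracket]
  let ψ : M →ₗ[ℂ] M →ₗ[ℂ] M := br + br.flip
  have hψ : ∀ a b c : M, a - b ∈ R → ψ a c = ψ b c := fun a b c hab ↦ by
    rw [← sub_eq_zero, ← LinearMap.sub_apply, ← map_sub]
    exact hskew.skew _ hab c
  have hψ_symm : ∀ a b : M, ψ a b = ψ b a := fun a b ↦ add_comm _ _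
  have hg : ψ.compl₁₂ t t = 0 := by
    refine LieAlgebra.IsKilling.eq_zero_of_isSl2Triple (S := S) _ (fun x y z ↦ ?_) fun h e f T ↦ ?_
    · simp only [LinearMap.compl₁₂_apply]
      rw [← hψ _ _ _ (ht_lie x y), hψ_symm (t y), ← hψ _ _ _ (ht_lie x z), hψ_symm _ (t y)]
      exact hleib.add_bracket_eq_neg hcent _ _ _
    · have T' : IsSl2TripleMod br R (t h) (t e) (t f) := by
        refine ⟨?_, ?_, ?_⟩
        · simpa only [T.lie_e_f] using ht_lie e f
        · simpa only [T.lie_h_e_smul ℂ, map_smul] using ht_lie h e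
        · simpa only [T.lie_lie_smul_f ℂ, map_neg, map_smul, sub_neg_eq_add] using ht_lie h f
      have h0 := T'.bracket_self_eq_zero hleib hcent hskew
      change br _ _ + br _ _ = 0
      rw [h0, add_zero]
  intro a ha
  refine bracket_self_eq_zero_of_sub_mem hskew.skew
    (hsub a ha (t ⟨σ a, a, ha, rfl⟩) (htL _) (hσt ⟨σ a, a, ha, rfl⟩).symm) ?_
  have h2 := congr($hg ⟨σ a, a, ha, rfl⟩ ⟨σ a, a, ha, rfl⟩)
  rw [LinearMap.compl₁₂_apply, LinearMap.zero_apply, LinearMap.zero_apply] at h2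
  exact (smul_eq_zero_iff_right (two_ne_zero (α := ℂ))).mp ((two_smul ℂ _).trans h2)
end

section
/- Let M be a finite-dimensional complex left central Leibniz algebra with radical R. Then the Lie algebra M/R has no nonzero ideal that is semisimple as a Lie algebra; in particular, every minimal nonzero ideal of M/R is abelian. -/
open Submodule

section SlTwo

variable {V : Type*} [AddCommGroup V] [Module ℂ V]

/-- If `T` maps `v` into a `T`-stable subspace `K`, then `v` is congruent modulo `K` to an element
of the generalized kernel of `T`. -/
theorem exists_sub_mem_and_mem_maxGenEigenspace_zero [FiniteDimensional ℂ V] (T : Module.End ℂ V)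
    (K : Submodule ℂ V) (hK : ∀ k ∈ K, T k ∈ K) {v : V} (hv : T v ∈ K) :
    ∃ v' : V, v' - v ∈ K ∧ ∃ n : ℕ, (T ^ n) v' = 0 := by
  obtain ⟨n, hn⟩ := (LinearMap.eventually_iInf_range_pow_eq (T.restrict hK)).exists_forall_of_atTop
  have h : ((T.restrict hK) ^ n) ⟨T v, hv⟩ ∈ LinearMap.range ((T.restrict hK) ^ (n + 1)) := by
    rw [← hn (n + 1) (by lia), hn n le_rfl]
    exact ⟨_, rfl⟩
  obtain ⟨k, hk⟩ := h
  refine ⟨v - k, by simp, n + 1, ?_⟩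
  have := congrArg Subtype.val hk
  rw [Module.End.pow_restrict _, Module.End.pow_restrict _] at this
  simp only [LinearMap.coe_restrict_apply] at this
  rw [map_sub, this, pow_succ, Module.End.mul_apply, sub_self]

theorem exists_pow_apply_eq_zero_of_eigenvector [FiniteDimensional ℂ V] {F H : Module.End ℂ V}
    (hHF : ∀ v, H (F v) - F (H v) = -(2 : ℂ) • F v) {v : V} {μ : ℂ} (hv : H v = μ • v) :
    ∃ n : ℕ, (F ^ n) v = 0 := by
  by_contra! contra
  have hpow (n : ℕ) : H ((F ^ n) v) = (μ - 2 * n) • (F ^ n) v := by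
    induction n with
    | zero => simpa using hv
    | succ n ih =>
      have := hHF ((F ^ n) v)
      rw [ih, sub_eq_iff_eq_add] at this
      rw [pow_succ', Module.End.mul_apply, this, map_smul, ← add_smul]
      congr 1
      push_cast
      ring
  have hinj : Function.Injective (fun n : ℕ ↦ μ - 2 * (n : ℂ)) := fun a b hab ↦ by simpa using hab
  have hev (n : ℕ) : H.HasEigenvalue (μ - 2 * (n : ℂ)) :=
    Module.End.hasEigenvalue_of_hasEigenvector
      (Module.End.hasEigenvector_iff.mpr ⟨Module.End.mem_eigenspace_iff.mpr (hpow n), contra n⟩)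
  exact Set.infinite_range_of_injective hinj
    (Set.Finite.subset (Module.End.finite_hasEigenvalue H)
      (by rintro _ ⟨n, rfl⟩; exact hev n))

/-- In a finite-dimensional `sl₂`-module, `F E` is injective on the weight space of weight `-2`. -/
theorem eq_zero_of_lower_raise_eq_zero [FiniteDimensional ℂ V] {E F H : Module.End ℂ V}
    (hEF : ∀ v, E (F v) - F (E v) = H v)
    (hHF : ∀ v, H (F v) - F (H v) = -(2 : ℂ) • F v) {v : V} (hv : H v = -(2 : ℂ) • v)
    (hFE : F (E v) = 0) : v = 0 := by
  have hpow (n : ℕ) : H ((F ^ n) v) = (-2 - 2 * n : ℂ) • (F ^ n) v := by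
    induction n with
    | zero => simpa using hv
    | succ n ih =>
      have := hHF ((F ^ n) v)
      rw [ih, sub_eq_iff_eq_add] at this
      rw [pow_succ', Module.End.mul_apply, this, map_smul, ← add_smul]
      congr 1
      push_cast
      ring
  have hraise (n : ℕ) : F (E ((F ^ n) v)) = (-(n * (n + 1)) : ℂ) • (F ^ n) v := by
    induction n with
    | zero => simpa using hFE
    | succ n ih =>
      have := hEF ((F ^ n) v)
      rw [ih, hpow, sub_eq_iff_eq_add] at this
      rw [pow_succ', Module.End.mul_apply, this, ← add_smul, map_smul]
      congr 1
      push_cast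
      ring
  obtain ⟨n, hn⟩ := exists_pow_apply_eq_zero_of_eigenvector hHF hv
  induction n with
  | zero => simpa using hn
  | succ n ih =>
    apply ih
    have := hEF ((F ^ n) v)
    rw [← Module.End.mul_apply F, ← pow_succ', hn, map_zero, hraise, hpow, zero_sub, ← neg_smul,
      ← sub_eq_zero, ← sub_smul, smul_eq_zero] at this
    refine this.resolve_left fun h ↦ ?_
    have h' : ((n : ℂ) + 1) * (n + 2) = 0 := by linear_combination h
    norm_cast at h'

/-- In a finite-dimensional `sl₂`-module, `E²` is injective on the generalized weight space of
weight `-2`. -/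
theorem eq_zero_of_raise_raise_eq_zero [FiniteDimensional ℂ V] {E F H : Module.End ℂ V}
    (hEF : ∀ v, E (F v) - F (E v) = H v)
    (hHE : ∀ v, H (E v) - E (H v) = (2 : ℂ) • E v)
    (hHF : ∀ v, H (F v) - F (H v) = -(2 : ℂ) • F v) {v : V} {n : ℕ}
    (hv : ((H - (-2 : ℂ) • 1) ^ n) v = 0) (hE : E (E v) = 0) : v = 0 := by
  induction n generalizing v with
  | zero => simpa using hv
  | succ n ih =>
    have hHE' (w : V) : H (E w) = (2 : ℂ) • E w + E (H w) := sub_eq_iff_eq_add.mp (hHE w)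
    have hHv : H v = -(2 : ℂ) • v := by
      rw [← sub_eq_zero]
      have key : (H - (-2 : ℂ) • (1 : Module.End ℂ V)) v = 0 := by
        refine ih (by rwa [pow_succ, Module.End.mul_apply] at hv) ?_
        have h1 : E (E (H v)) = 0 := by
          have h2 := hHE' (E v)
          rw [hHE' v, hE, map_add, map_smul, hE] at h2
          simpa using h2.symm
        simp [h1, hE]
      simpa using key
    have hHEv : H (E v) = 0 := by
      rw [hHE' v, hHv]
      simp
    have hz : F (E v) = 0 := by
      apply eq_zero_of_lower_raise_eq_zero hEF hHF
      · have := hHF (E v)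
        rwa [hHEv, map_zero, sub_zero] at this
      · have := hEF (E v)
        rw [hE, map_zero, sub_zero, hHEv] at this
        rw [this, map_zero]
    exact eq_zero_of_lower_raise_eq_zero hEF hHF hHv hz

/-- A version of `eq_zero_of_raise_raise_eq_zero` for a subquotient `A / W`. -/
theorem mem_of_raise_raise_mem [FiniteDimensional ℂ V] {E F H : Module.End ℂ V}
    {A W : Submodule ℂ V}
    (hEA : ∀ v ∈ A, E v ∈ A) (hFA : ∀ v ∈ A, F v ∈ A) (hHA : ∀ v ∈ A, H v ∈ A)
    (hEW : ∀ v ∈ W, E v ∈ W) (hFW : ∀ v ∈ W, F v ∈ W) (hHW : ∀ v ∈ W, H v ∈ W)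
    (hEF : ∀ v ∈ A, E (F v) - F (E v) - H v ∈ W)
    (hHE : ∀ v ∈ A, H (E v) - E (H v) - (2 : ℂ) • E v ∈ W)
    (hHF : ∀ v ∈ A, H (F v) - F (H v) - -(2 : ℂ) • F v ∈ W) {v : V} (hvA : v ∈ A) {n : ℕ}
    (hv : ((H - (-2 : ℂ) • 1) ^ n) v = 0) (hE : E (E v) = 0) : v ∈ W := by
  let W' : Submodule ℂ A := W.submoduleOf A
  let q (T : Module.End ℂ V) (hA : ∀ v ∈ A, T v ∈ A) (hW : ∀ v ∈ W, T v ∈ W) :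
      Module.End ℂ (A ⧸ W') :=
    W'.mapQ W' (T.restrict hA) fun w hw ↦ hW _ hw
  have hq (T : Module.End ℂ V) (hA : ∀ v ∈ A, T v ∈ A) (hW : ∀ v ∈ W, T v ∈ W) (a : A) :
      q T hA hW (W'.mkQ a) = W'.mkQ ⟨T a, hA a a.2⟩ := rfl
  have hmk (a b : A) (h : (a : V) - b ∈ W) : W'.mkQ a = W'.mkQ b :=
    (Submodule.Quotient.eq W').mpr h
  have hsurj := W'.mkQ_surjective
  have hpow (n : ℕ) (a : A) (b : V) (hb : ((H - (-2 : ℂ) • 1) ^ n) (a : V) = b) :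
      ∃ hbA : b ∈ A, ((q H hHA hHW - (-2 : ℂ) • 1) ^ n) (W'.mkQ a) = W'.mkQ ⟨b, hbA⟩ := by
    induction n generalizing b with
    | zero => subst hb; exact ⟨a.2, rfl⟩
    | succ n ih =>
      obtain ⟨h1, h2⟩ := ih _ rfl
      rw [pow_succ', Module.End.mul_apply] at hb
      set c := ((H - (-2 : ℂ) • 1) ^ n) (a : V)
      have hb' : b = H c - (-2 : ℂ) • c := by rw [← hb]; rfl
      subst hb'
      refine ⟨A.sub_mem (hHA _ h1) (A.smul_mem _ h1), ?_⟩
      rw [pow_succ', Module.End.mul_apply, h2]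
      rfl
  have key : W'.mkQ ⟨v, hvA⟩ = 0 := by
    refine eq_zero_of_raise_raise_eq_zero (E := q E hEA hEW) (F := q F hFA hFW)
      (H := q H hHA hHW) (n := n) ?_ ?_ ?_ ?_ ?_
    · intro w
      obtain ⟨a, rfl⟩ := hsurj w
      simp only [hq, ← map_sub]
      exact hmk _ _ (hEF a a.2)
    · intro w
      obtain ⟨a, rfl⟩ := hsurj w
      simp only [hq, ← map_sub, ← map_smul]
      exact hmk _ _ (hHE a a.2)
    · intro w
      obtain ⟨a, rfl⟩ := hsurj w
      simp only [hq, ← map_sub, ← map_smul]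
      exact hmk _ _ (hHF a a.2)
    · obtain ⟨h1, h2⟩ := hpow n ⟨v, hvA⟩ 0 hv
      rw [h2]
      exact map_zero _
    · simp only [hq, hE]
      exact map_zero _
  exact (Submodule.Quotient.mk_eq_zero W').mp key

end SlTwo

section Leibniz

variable {M : Type*} [AddCommGroup M] [Module ℂ M]

/-- For a bracket and an operator `D` acting as a derivation on it, the bracket respects the
generalized eigenspaces of `D`. -/
theorem br_mem_maxGenEigenspace {br : M →ₗ[ℂ] M →ₗ[ℂ] M} {D : Module.End ℂ M}
    (hD : ∀ a b, D (br a b) = br (D a) b + br a (D b)) {μ ν ρ : ℂ} (hρ : μ + ν = ρ) {a b : M}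
    (ha : a ∈ D.maxGenEigenspace μ) (hb : b ∈ D.maxGenEigenspace ν) :
    br a b ∈ D.maxGenEigenspace ρ := by
  subst hρ
  rw [Module.End.mem_maxGenEigenspace] at ha hb ⊢
  obtain ⟨i, hi⟩ := ha
  obtain ⟨j, hj⟩ := hb
  refine ⟨i + j, ?_⟩
  obtain ⟨n, hn⟩ : ∃ n, i + j = n := ⟨_, rfl⟩
  rw [hn]
  induction n generalizing i j a b with
  | zero =>
    obtain rfl : i = 0 := by lia
    rw [pow_zero, Module.End.one_apply] at hi
    simp [hi]
  | succ n ih =>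
    rcases i with _ | i
    · rw [pow_zero, Module.End.one_apply] at hi
      simp [hi]
    rcases j with _ | j
    · rw [pow_zero, Module.End.one_apply] at hj
      simp [hj]
    have key : (D - (μ + ν) • (1 : Module.End ℂ M)) (br a b) =
        br ((D - μ • (1 : Module.End ℂ M)) a) b + br a ((D - ν • (1 : Module.End ℂ M)) b) := by
      simp [hD, add_smul]
      abel
    rw [pow_succ, Module.End.mul_apply, key, map_add,
      ih i (by rwa [pow_succ, Module.End.mul_apply] at hi) (j + 1) hj (by lia),
      ih (i + 1) hi j (by rwa [pow_succ, Module.End.mul_apply] at hj) (by lia), add_zero]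

section Engel

attribute [local instance] LieRing.ofAssociativeRing

/-- By Engel's theorem, if an ideal acts by nilpotent left multiplications, then there is a finite
filtration by left submodules on whose quotients the ideal acts trivially. -/
theorem exists_filtration_of_isNilpotent [FiniteDimensional ℂ M] {br : M →ₗ[ℂ] M →ₗ[ℂ] M}
    (hleib : IsLeftLeibniz br) {K : Submodule ℂ M} (hK : IsTwoSidedIdeal br K)
    (hnil : ∀ k ∈ K, IsNilpotent (br k)) :
    ∃ (W : ℕ → Submodule ℂ M) (n : ℕ), W 0 = ⊤ ∧ W n = ⊥ ∧
      (∀ i a, ∀ w ∈ W i, br a w ∈ W i) ∧ ∀ i, ∀ k ∈ K, ∀ w ∈ W i, br k w ∈ W (i + 1) := by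
  have hcomm (a b : M) : ⁅br a, br b⁆ = br (br a b) := by
    ext c
    rw [Ring.lie_def, LinearMap.sub_apply, Module.End.mul_apply, Module.End.mul_apply, hleib a b c,
      add_sub_cancel_right]
  let L : LieSubalgebra ℂ (Module.End ℂ M) :=
    { K.map br with
      lie_mem' := by
        rintro _ _ ⟨a, ha, rfl⟩ ⟨b, hb, rfl⟩
        exact ⟨br a b, (hK a b hb).1, (hcomm a b).symm⟩ }
  have hL (k : M) (hk : k ∈ K) : br k ∈ L := ⟨k, hk, rfl⟩
  have hnilp : LieModule.IsNilpotent L M := by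
    rw [LieModule.isNilpotent_iff_forall' (R := ℂ)]
    rintro ⟨_, k, hk, rfl⟩
    exact hnil k hk
  obtain ⟨n, hn⟩ := (LieModule.isNilpotent_iff ℂ L M).mp hnilp
  refine ⟨fun i ↦ LieModule.lowerCentralSeries ℂ L M i, n, rfl, ?_, ?_, ?_⟩
  · simp [hn]
  · intro i
    induction i with
    | zero => intro a w _; exact Submodule.mem_top
    | succ i ih =>
      intro a w hw
      dsimp only at hw ⊢
      rw [LieModule.lowerCentralSeries_succ, LieSubmodule.lieIdeal_oper_eq_linear_span'] at hw ⊢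
      induction hw using Submodule.span_induction with
      | mem w hw =>
        obtain ⟨⟨_, k, hk, rfl⟩, -, m, hm, rfl⟩ := hw
        change br a (br k m) ∈ _
        rw [hleib]
        refine add_mem (Submodule.subset_span ?_) (Submodule.subset_span ?_)
        · exact ⟨⟨_, hL _ (hK a k hk).1⟩, LieSubmodule.mem_top _, m, hm, rfl⟩
        · exact ⟨⟨_, hL k hk⟩, LieSubmodule.mem_top _, _, ih a m hm, rfl⟩
      | zero => simp
      | add x y _ _ hx hy => rw [map_add]; exact add_mem hx hy
      | smul c x _ hx => rw [map_smul]; exact Submodule.smul_mem _ c hx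
  · intro i k hk w hw
    dsimp only
    rw [LieModule.lowerCentralSeries_succ]
    exact LieSubmodule.lie_mem_lie (LieSubmodule.mem_top (⟨_, hL k hk⟩ : L)) hw

end Engel

/-- `E²` is injective on the generalized eigenspace of `H` for `-2` when `E`, `F`, `H` satisfy the
`sl₂` relations on the quotients of a finite filtration. -/
theorem eq_zero_of_raise_raise_eq_zero_of_filtration [FiniteDimensional ℂ M]
    {W : ℕ → Submodule ℂ M} {N : ℕ} (hW0 : W 0 = ⊤) (hWN : W N = ⊥) {E F H : Module.End ℂ M}
    (hE : ∀ i, ∀ w ∈ W i, E w ∈ W i) (hF : ∀ i, ∀ w ∈ W i, F w ∈ W i)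
    (hH : ∀ i, ∀ w ∈ W i, H w ∈ W i)
    (hEF : ∀ i, ∀ v ∈ W i, E (F v) - F (E v) - H v ∈ W (i + 1))
    (hHE : ∀ i, ∀ v ∈ W i, H (E v) - E (H v) - (2 : ℂ) • E v ∈ W (i + 1))
    (hHF : ∀ i, ∀ v ∈ W i, H (F v) - F (H v) - -(2 : ℂ) • F v ∈ W (i + 1)) {v : M}
    (hv : v ∈ H.maxGenEigenspace (-2)) (hEv : E (E v) = 0) : v = 0 := by
  obtain ⟨n, hn⟩ := Module.End.mem_maxGenEigenspace _ _ _ |>.mp hv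
  have key (i : ℕ) : v ∈ W i := by
    induction i with
    | zero => simp [hW0]
    | succ i ih =>
      exact mem_of_raise_raise_mem (hE i) (hF i) (hH i) (hE _) (hF _) (hH _) (hEF i) (hHE i)
        (hHF i) ih hn hEv
  simpa [hWN] using key N

theorem mem_maxGenEigenspace_neg {H : Module.End ℂ M} {μ : ℂ} {v : M} :
    v ∈ (-H).maxGenEigenspace μ ↔ v ∈ H.maxGenEigenspace (-μ) := by
  simp only [Module.End.mem_maxGenEigenspace]
  refine exists_congr fun k ↦ ?_
  rw [show -H - μ • (1 : Module.End ℂ M) = -(H - (-μ) • 1) by rw [neg_smul]; abel, neg_pow]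
  rcases neg_one_pow_eq_or (Module.End ℂ M) k with h | h <;> simp [h]

/-- Lifting of the Cartan element of an `sl₂`-triple modulo an ideal `K` acting nilpotently
to an element of square zero. -/
theorem exists_square_zero_lift_of_isNilpotent [FiniteDimensional ℂ M] {br : M →ₗ[ℂ] M →ₗ[ℂ] M}
    (hleib : IsLeftLeibniz br) (hcent : IsLeftCentral br) {K : Submodule ℂ M}
    (hK : IsTwoSidedIdeal br K) (hsq : ∀ a b, br a b + br b a ∈ K)
    (hnil : ∀ k ∈ K, IsNilpotent (br k)) {h e f : M} (hef : br e f - h ∈ K)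
    (hhe : br h e - (2 : ℂ) • e ∈ K) (hhf : br h f - -(2 : ℂ) • f ∈ K) :
    ∃ h', h' - h ∈ K ∧ br h' h' = 0 := by
  have hleib' (a b c : M) : br a (br b c) - br b (br a c) = br (br a b) c :=
    sub_eq_of_eq_add (hleib a b c)
  have hcent' (a b : M) : br a (br b b) = 0 := hcent a b
  have hsym (a b c : M) : br a (br b c + br c b) = 0 := by
    have := hcent a (b + c)
    simp only [map_add, LinearMap.add_apply, hcent'] at this ⊢
    simpa [add_comm] using this
  have hadj {x : M} {μ : ℂ} (hx : br h x - μ • x ∈ K) :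
      ∃ x', x' - x ∈ K ∧ x' ∈ Module.End.maxGenEigenspace (br h) μ ∧ br h x' - μ • x' ∈ K := by
    obtain ⟨x', hx', n, hn⟩ := exists_sub_mem_and_mem_maxGenEigenspace_zero
      (br h - μ • (1 : Module.End ℂ M)) K (fun k hk ↦ K.sub_mem (hK h k hk).1 (K.smul_mem _ hk)) hx
    refine ⟨x', hx', (Module.End.mem_maxGenEigenspace _ _ _).mpr ⟨n, hn⟩, ?_⟩
    have : br h x' - μ • x' = (br h (x' - x) - μ • (x' - x)) + (br h x - μ • x) := by
      rw [map_sub, smul_sub]; abel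
    rw [this]
    exact K.add_mem (K.sub_mem (hK h _ hx').1 (K.smul_mem _ hx')) hx
  obtain ⟨E, hEe, hE2, hhE⟩ := hadj hhe
  obtain ⟨F, hFf, hF2, hhF⟩ := hadj hhf
  have hEF : br E F - h ∈ K := by
    have : br E F - h = br (E - e) F + br e (F - f) + (br e f - h) := by
      simp only [map_sub, LinearMap.sub_apply]; abel
    rw [this]
    exact K.add_mem (K.add_mem (hK F _ hEe).2 (hK e _ hFf).1) hef
  obtain ⟨W, N, hW0, hWN, hWM, hWK⟩ := exists_filtration_of_isNilpotent hleib hK hnil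
  have relEF (i : ℕ) (v : M) (hv : v ∈ W i) :
      br E (br F v) - br F (br E v) - br h v ∈ W (i + 1) := by
    rw [hleib', ← LinearMap.sub_apply, ← map_sub]
    exact hWK i _ hEF v hv
  have relHE (i : ℕ) (v : M) (hv : v ∈ W i) :
      br h (br E v) - br E (br h v) - (2 : ℂ) • br E v ∈ W (i + 1) := by
    rw [hleib', ← LinearMap.smul_apply, ← map_smul, ← LinearMap.sub_apply, ← map_sub]
    exact hWK i _ hhE v hv
  have relHF (i : ℕ) (v : M) (hv : v ∈ W i) :
      br h (br F v) - br F (br h v) - -(2 : ℂ) • br F v ∈ W (i + 1) := by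
    rw [hleib', ← LinearMap.smul_apply, ← map_smul, ← LinearMap.sub_apply, ← map_sub]
    exact hWK i _ hhF v hv
  have injE (v : M) (hv : v ∈ Module.End.maxGenEigenspace (br h) (-2))
      (h0 : br E (br E v) = 0) : v = 0 :=
    eq_zero_of_raise_raise_eq_zero_of_filtration hW0 hWN (fun i ↦ hWM i E) (fun i ↦ hWM i F)
      (fun i ↦ hWM i h) relEF relHE relHF hv h0
  have injF (v : M) (hv : v ∈ Module.End.maxGenEigenspace (br h) 2)
      (h0 : br F (br F v) = 0) : v = 0 := by
    refine eq_zero_of_raise_raise_eq_zero_of_filtration (E := br F) (F := br E) (H := - br h)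
      hW0 hWN (fun i ↦ hWM i F) (fun i ↦ hWM i E)
      (fun i w hw ↦ (W i).neg_mem (hWM i h w hw)) ?_ ?_ ?_
      (mem_maxGenEigenspace_neg.mpr (by simpa using hv)) h0
    · intro i v hv
      convert (W (i + 1)).neg_mem (relEF i v hv) using 1
      simp only [LinearMap.neg_apply]
      abel
    · intro i v hv
      convert (W (i + 1)).neg_mem (relHF i v hv) using 1
      simp only [LinearMap.neg_apply, map_neg, neg_smul]
      abel
    · intro i v hv
      convert (W (i + 1)).neg_mem (relHE i v hv) using 1
      simp only [LinearMap.neg_apply, map_neg, neg_smul]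
      abel
  have hder (a b : M) : br h (br a b) = br (br h a) b + br a (br h b) := hleib h a b
  let Kneg : Submodule ℂ M := K ⊓ Module.End.maxGenEigenspace (br h) (-2)
  let Kpos : Submodule ℂ M := K ⊓ Module.End.maxGenEigenspace (br h) 2
  have hEK (v : M) (hv : v ∈ Kneg) : br E (br E v) ∈ Kpos :=
    ⟨(hK _ _ (hK _ _ hv.1).1).1, br_mem_maxGenEigenspace hder (by norm_num) hE2
      (br_mem_maxGenEigenspace (ρ := 0) hder (by norm_num) hE2 hv.2)⟩
  have hFK (v : M) (hv : v ∈ Kpos) : br F (br F v) ∈ Kneg :=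
    ⟨(hK _ _ (hK _ _ hv.1).1).1, br_mem_maxGenEigenspace hder (by norm_num) hF2
      (br_mem_maxGenEigenspace (ρ := 0) hder (by norm_num) hF2 hv.2)⟩
  let EE : Kneg →ₗ[ℂ] Kpos := ((br E) ∘ₗ (br E)).restrict hEK
  let FF : Kpos →ₗ[ℂ] Kneg := ((br F) ∘ₗ (br F)).restrict hFK
  have hEE : Function.Injective EE := by
    rw [← LinearMap.ker_eq_bot, LinearMap.ker_eq_bot']
    intro v hv
    exact Subtype.ext (injE v v.2.2 (congrArg Subtype.val hv))
  have hFF : Function.Injective FF := by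
    rw [← LinearMap.ker_eq_bot, LinearMap.ker_eq_bot']
    intro v hv
    exact Subtype.ext (injF v v.2.2 (congrArg Subtype.val hv))
  have hsurj : Function.Surjective EE :=
    (LinearMap.injective_iff_surjective_of_finrank_eq_finrank
      (le_antisymm (LinearMap.finrank_le_finrank_of_injective hEE)
        (LinearMap.finrank_le_finrank_of_injective hFF))).mp hEE
  have hr : br E (br E F) + (2 : ℂ) • E ∈ Kpos := by
    refine ⟨?_, add_mem (br_mem_maxGenEigenspace hder (by norm_num) hE2
      (br_mem_maxGenEigenspace (ρ := 0) hder (by norm_num) hE2 hF2)) (Submodule.smul_mem _ _ hE2)⟩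
    have : br E (br E F) + (2 : ℂ) • E =
        br E (br E F - h) + (br E h + br h E) - (br h E - (2 : ℂ) • E) := by
      rw [map_sub]; abel
    rw [this]
    exact K.sub_mem (K.add_mem (hK _ _ hEF).1 (hsq _ _)) hhE
  obtain ⟨⟨u, hu⟩, hu'⟩ := hsurj ⟨_, hr⟩
  replace hu' : br E (br E u) = br E (br E F) + (2 : ℂ) • E := congrArg Subtype.val hu'
  set F' := F - u with hF'
  have hF'2 : F' ∈ Module.End.maxGenEigenspace (br h) (-2) := sub_mem hF2 hu.2
  have hEEF : br E (br E F') = -((2 : ℂ) • E) := by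
    rw [hF', map_sub, map_sub, hu']; abel
  set h' := br E F' with hh'
  have hh'0 : h' ∈ Module.End.maxGenEigenspace (br h) 0 :=
    br_mem_maxGenEigenspace hder (by norm_num) hE2 hF'2
  have hh'E : br h' E = (2 : ℂ) • E := by
    have h1 : br h' E + br E h' ∈ Module.End.maxGenEigenspace (br h) 2 :=
      add_mem (br_mem_maxGenEigenspace hder (by norm_num) hh'0 hE2)
        (br_mem_maxGenEigenspace hder (by norm_num) hE2 hh'0)
    have h2 : br h' E + br E h' ∈ Module.End.maxGenEigenspace (br h) 0 :=
      (Module.End.mem_maxGenEigenspace _ _ _).mpr ⟨1, by simpa using hsym h h' E⟩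
    have h3 : br h' E + br E h' = 0 := by
      have := Module.End.disjoint_genEigenspace (br h) (two_ne_zero : (2 : ℂ) ≠ 0) ⊤ ⊤
      exact Submodule.disjoint_def.mp this _ h1 h2
    rw [hh', hEEF, ← hh', add_neg_eq_zero] at h3
    exact h3
  have hsquare : br h' h' = br E ((2 : ℂ) • F' + br h' F') := by
    conv_lhs => rw [hh', ← hh', hleib h' E F', hh'E]
    simp
  have hq : (2 : ℂ) • F' + br h' F' = 0 := by
    refine injE _ (add_mem (Submodule.smul_mem _ _ hF'2)
      (br_mem_maxGenEigenspace hder (by norm_num) hh'0 hF'2)) ?_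
    rw [← hsquare, hcent]
  refine ⟨h', ?_, by rw [hsquare, hq, map_zero]⟩
  have : h' - h = (br E F - h) - br E u := by rw [hh', hF', map_sub]; abel
  rw [this]
  exact K.sub_mem hEF (hK _ _ hu.1).1

/-- Lifting of the Cartan element of an `sl₂`-triple modulo an ideal containing all `[a,b] + [b,a]`
to an element of square zero. -/
theorem exists_square_zero_lift [FiniteDimensional ℂ M] {br : M →ₗ[ℂ] M →ₗ[ℂ] M}
    (hleib : IsLeftLeibniz br) (hcent : IsLeftCentral br) {K : Submodule ℂ M}
    (hK : IsTwoSidedIdeal br K) (hsq : ∀ a b, br a b + br b a ∈ K) {h e f : M}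
    (hef : br e f - h ∈ K) (hhe : br h e - (2 : ℂ) • e ∈ K) (hhf : br h f - -(2 : ℂ) • f ∈ K) :
    ∃ h', h' - h ∈ K ∧ br h' h' = 0 := by
  induction hn : Module.finrank ℂ M using Nat.strong_induction_on generalizing M with
  | h n ih =>
  subst hn
  by_cases hnil : ∀ k ∈ K, IsNilpotent (br k)
  · exact exists_square_zero_lift_of_isNilpotent hleib hcent hK hsq hnil hef hhe hhf
  push Not at hnil
  obtain ⟨k, hk, hknil⟩ := hnil
  set N : Submodule ℂ M := Module.End.maxGenEigenspace (br k) 0 with hN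
  have hNbr (a b : N) : br a b ∈ N :=
    br_mem_maxGenEigenspace (hleib k) (add_zero 0) a.2 b.2
  have hlt : Module.finrank ℂ N < Module.finrank ℂ M := by
    refine Submodule.finrank_lt (lt_top_iff_ne_top.mpr fun htop ↦ hknil ?_).ne
    rw [Module.End.isNilpotent_iff_of_finite]
    intro m
    have hm : m ∈ N := htop ▸ Submodule.mem_top
    simpa [hN, Module.End.mem_maxGenEigenspace] using hm
  have hlift (x : M) : ∃ x' : N, (x' : M) - x ∈ K := by
    obtain ⟨x', hx', n, hn⟩ := exists_sub_mem_and_mem_maxGenEigenspace_zero (br k) K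
      (fun y hy ↦ (hK k y hy).1) (hK x k hk).2
    exact ⟨⟨x', (Module.End.mem_maxGenEigenspace _ _ _).mpr ⟨n, by simpa using hn⟩⟩, hx'⟩
  obtain ⟨e', he'⟩ := hlift e
  obtain ⟨f', hf'⟩ := hlift f
  obtain ⟨h', hh'⟩ := hlift h
  have hbrK {a a' b b' : M} (ha : a' - a ∈ K) (hb : b' - b ∈ K) : br a' b' - br a b ∈ K := by
    have : br a' b' - br a b = br (a' - a) b' + br a (b' - b) := by
      simp only [map_sub, LinearMap.sub_apply]; abel
    rw [this]
    exact K.add_mem (hK b' _ ha).2 (hK a _ hb).1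
  have hcongr {x x' y y' : M} (hx : x' - x ∈ K) (hy : y' - y ∈ K) (hxy : x - y ∈ K) :
      x' - y' ∈ K := by
    have : x' - y' = (x' - x) + (x - y) - (y' - y) := by abel
    rw [this]
    exact K.sub_mem (K.add_mem hx hxy) hy
  have hsmul {x x' : M} (c : ℂ) (hx : x' - x ∈ K) : c • x' - c • x ∈ K := by
    rw [← smul_sub]; exact K.smul_mem c hx
  let br' : N →ₗ[ℂ] N →ₗ[ℂ] N :=
    LinearMap.mk₂ ℂ (fun a b ↦ ⟨br a b, hNbr a b⟩) (fun a b c ↦ by ext; simp)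
      (fun c a b ↦ by ext; simp) (fun a b c ↦ by ext; simp) (fun c a b ↦ by ext; simp)
  have hbr' (a b : N) : (br' a b : M) = br a b := rfl
  obtain ⟨x, hxK, hxx⟩ := ih _ hlt (br := br') (K := K.submoduleOf N) (h := h') (e := e') (f := f')
    (fun a b c ↦ Subtype.ext (hleib a b c)) (fun a b ↦ Subtype.ext (hcent a b))
    (fun m u hu ↦ hK m u hu) (fun a b ↦ hsq a b) (hcongr (hbrK he' hf') hh' hef)
    (hcongr (hbrK hh' he') (hsmul 2 he') hhe) (hcongr (hbrK hh' hf') (hsmul (-2) hf') hhf) rfl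
  refine ⟨x, ?_, congrArg Subtype.val hxx⟩
  rw [← sub_add_sub_cancel (x : M) h' h]
  exact K.add_mem hxK hh'

end Leibniz

section Killing

open LieAlgebra LieModule LieAlgebra.IsKilling

variable {L : Type*} [LieRing L] [LieAlgebra ℂ L]

/-- An invariant bilinear map on a complex Lie algebra with nondegenerate Killing form which
vanishes at `(h, h)` for every `sl₂`-triple `(h, e, f)` vanishes on brackets. -/
theorem apply_lie_eq_zero_of_isSl2Triple [FiniteDimensional ℂ L] [IsKilling ℂ L]
    {W : Type*} [AddCommGroup W] [Module ℂ W] {Φ : L →ₗ[ℂ] L →ₗ[ℂ] W}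
    (hinv : ∀ x y z : L, Φ ⁅x, y⁆ z = -Φ y ⁅x, z⁆)
    (hsl : ∀ h e f : L, IsSl2Triple h e f → Φ h h = 0) (x y z : L) : Φ ⁅x, y⁆ z = 0 := by
  obtain ⟨c, hc⟩ := exists_isCartanSubalgebra_engel ℂ L
  set H := LieSubalgebra.engel ℂ c
  have hroot (α : Weight ℂ H L) (hα : α.IsNonZero) (x : L) (hx : x ∈ rootSpace H α) (z : L) :
      Φ x z = 0 := by
    have hz : z ∈ ⨆ χ : Weight ℂ H L, genWeightSpace L χ :=
      (iSup_genWeightSpace_eq_top' ℂ H L) ▸ LieSubmodule.mem_top z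
    induction hz using LieSubmodule.iSup_induction' with
    | mem β z hz =>
      by_cases hβ : (β : H → ℂ) = -α
      · obtain ⟨h, e, f, ht, he, hf⟩ := exists_isSl2Triple_of_weight_isNonZero hα
        have hef : Φ e f = 0 := by
          have h1 := hsl h e f ht
          conv_lhs at h1 => arg 2; rw [← ht.lie_e_f]
          have h2 := hinv e h f
          rw [← lie_skew, ht.lie_h_e_nsmul, ← neg_eq_iff_eq_neg] at h2
          rw [← h2, ← Nat.cast_smul_eq_nsmul ℂ] at h1
          simpa using h1
        obtain ⟨a, ha⟩ := (finrank_eq_one_iff_of_nonzero' (⟨e, he⟩ : rootSpace H α)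
          (by simpa using ht.e_ne_zero)).mp (finrank_rootSpace_eq_one α hα) ⟨x, hx⟩
        rw [hβ] at hz
        obtain ⟨b, hb⟩ := (finrank_eq_one_iff_of_nonzero' (⟨f, hf⟩ : rootSpace H (-α))
          (by simpa using ht.f_ne_zero)).mp (finrank_rootSpace_eq_one (-α) (by simpa)) ⟨z, hz⟩
        have ha' : a • e = x := congrArg Subtype.val ha
        have hb' : b • f = z := congrArg Subtype.val hb
        simp [← ha', ← hb', hef]
      · obtain ⟨t, ht⟩ := Function.ne_iff.mp hβ
        have h1 := hinv t x z
        have hx' : ⁅(t : L), x⁆ = α t • x := lie_eq_smul_of_mem_rootSpace hx t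
        have hz' : ⁅(t : L), z⁆ = β t • z := lie_eq_smul_of_mem_rootSpace hz t
        rw [hx', hz', map_smul, map_smul, LinearMap.smul_apply, ← sub_eq_zero, sub_neg_eq_add,
          ← add_smul] at h1
        refine (smul_eq_zero.mp h1).resolve_left fun h ↦ ht ?_
        simpa using eq_neg_of_add_eq_zero_right h
    | zero => simp
    | add z w _ _ hz hw => simp [hz, hw]
  have hspan (x : L) : ∃ t ∈ H, ∀ z, Φ (x - t) z = 0 := by
    have hx : x ∈ ⨆ χ : Weight ℂ H L, genWeightSpace L χ :=
      (iSup_genWeightSpace_eq_top' ℂ H L) ▸ LieSubmodule.mem_top x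
    induction hx using LieSubmodule.iSup_induction' with
    | mem β x hx =>
      by_cases hβ : β.IsZero
      · refine ⟨x, ?_, by simp⟩
        rw [hβ.eq] at hx
        simpa using hx
      · exact ⟨0, H.zero_mem, by simpa using hroot β hβ x hx⟩
    | zero => exact ⟨0, H.zero_mem, by simp⟩
    | add x y _ _ hx hy =>
      obtain ⟨s, hs, hs'⟩ := hx
      obtain ⟨t, ht, ht'⟩ := hy
      refine ⟨s + t, H.add_mem hs ht, fun z ↦ ?_⟩
      rw [add_sub_add_comm, map_add, LinearMap.add_apply, hs', ht', add_zero]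
  obtain ⟨s, hs, hs'⟩ := hspan x
  obtain ⟨t, ht, ht'⟩ := hspan y
  have hst : ⁅s, t⁆ = 0 := congrArg Subtype.val (trivial_lie_zero H H ⟨s, hs⟩ ⟨t, ht⟩)
  have key : ⁅x, y⁆ = ⁅x, y - t⁆ - ⁅t, x - s⁆ := by
    rw [lie_sub, lie_sub, ← lie_skew t s, hst, ← lie_skew x t]; abel
  rw [key, map_sub, LinearMap.sub_apply, hinv, hinv, hs', ht']
  simp

/-- Let `π : M → L` be a surjection from a left central Leibniz algebra onto a Lie algebra whose
kernel is the radical of `M`. Then `L` has no nonzero ideal with nondegenerate Killing form. -/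
theorem eq_bot_of_isKilling {M : Type*} [AddCommGroup M] [Module ℂ M] [FiniteDimensional ℂ M]
    {br : M →ₗ[ℂ] M →ₗ[ℂ] M} (hleib : IsLeftLeibniz br) (hcent : IsLeftCentral br)
    {π : M →ₗ[ℂ] L} (hsurj : Function.Surjective π) (hπ : ∀ a b, π (br a b) = ⁅π a, π b⁆)
    (hker : ∀ x, π x = 0 ↔ ∀ a, br x a + br a x = 0) (I : LieIdeal ℂ L) [IsKilling ℂ I] :
    I = ⊥ := by
  have : FiniteDimensional ℂ L := Module.Finite.of_surjective π hsurj
  let ψ : M →ₗ[ℂ] M →ₗ[ℂ] M := br + br.flip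
  have hψ (a b : M) : ψ a b = br a b + br b a := rfl
  have hbrψ (a b c : M) : br a (ψ b c) = 0 := by
    have h1 := hcent a (b + c)
    have h2 : br a (br b b) = 0 := hcent a b
    have h3 : br a (br c c) = 0 := hcent a c
    simp only [map_add, LinearMap.add_apply, h2, h3] at h1
    simpa [hψ, add_comm] using h1
  have hψinv (a b c : M) : ψ (br a b) c = -ψ b (br a c) := by
    rw [eq_neg_iff_add_eq_zero, ← hbrψ a b c]
    simp only [hψ, map_add, hleib a b c, hleib a c b]
    abel
  obtain ⟨σ, hσ⟩ := π.exists_rightInverse_of_surjective (LinearMap.range_eq_top.mpr hsurj)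
  have hσ' (x : L) : π (σ x) = x := LinearMap.congr_fun hσ x
  have hψl {a a' : M} (h : π a = π a') (b : M) : ψ a b = ψ a' b := by
    rw [← sub_eq_zero, ← LinearMap.sub_apply, ← map_sub]
    exact (hker _).mp (by rw [map_sub, h, sub_self]) b
  have hψr {b b' : M} (h : π b = π b') (a : M) : ψ a b = ψ a b' := by
    rw [hψ, hψ, add_comm, ← hψ, hψl h, hψ, add_comm]
  have hπ' (x y : L) : π (σ ⁅x, y⁆) = π (br (σ x) (σ y)) := by simp [hσ', hπ]
  let Φ : L →ₗ[ℂ] L →ₗ[ℂ] M := ψ.compl₁₂ σ σ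
  have hΦ (x y : L) : Φ x y = ψ (σ x) (σ y) := rfl
  have hΦinv (x y z : L) : Φ ⁅x, y⁆ z = -Φ y ⁅x, z⁆ := by
    rw [hΦ, hΦ, hψl (hπ' x y), hψr (hπ' x z), hψinv]
  have hsub (x y : M) : π x = π y ↔ x - y ∈ LinearMap.ker π := by
    rw [LinearMap.mem_ker, map_sub, sub_eq_zero]
  have hideal : IsTwoSidedIdeal br (LinearMap.ker π) := fun m u hu ↦ by
    rw [LinearMap.mem_ker] at hu
    simp [hπ, hu]
  have hsl (h e f : I) (ht : IsSl2Triple h e f) : Φ h h = 0 := by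
    have h1 : ⁅(e : L), (f : L)⁆ = h := congrArg Subtype.val ht.lie_e_f
    have h2 : ⁅(h : L), (e : L)⁆ = (2 : ℂ) • e := congrArg Subtype.val (ht.lie_h_e_smul ℂ)
    have h3 : ⁅(h : L), (f : L)⁆ = -(2 : ℂ) • f := by
      rw [neg_smul]; exact congrArg Subtype.val (ht.lie_lie_smul_f ℂ)
    obtain ⟨h', hh', hsq⟩ := exists_square_zero_lift hleib hcent hideal
      (h := σ h) (e := σ e) (f := σ f) (fun a b ↦ by
        rw [LinearMap.mem_ker, map_add, hπ, hπ, ← lie_skew (π a), neg_add_cancel])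
      (by simp [hπ, hσ', h1]) (by simp [hπ, hσ', h2]) (by simp [hπ, hσ', h3])
    have hh : π (σ h) = π h' := ((hsub _ _).mpr hh').symm
    rw [hΦ, hψl hh, hψr hh, hψ, hsq, add_zero]
  have hI (x y z : I) : Φ ⁅(x : L), (y : L)⁆ z = 0 :=
    apply_lie_eq_zero_of_isSl2Triple (L := I)
      (Φ := Φ.compl₁₂ (I.incl : I →ₗ[ℂ] L) (I.incl : I →ₗ[ℂ] L))
      (fun x y z ↦ hΦinv x y z) hsl x y z
  have hzero (w x y : I) : ⁅w, ⁅x, y⁆⁆ = 0 := by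
    refine Subtype.ext ?_
    change ⁅(w : L), ⁅(x : L), (y : L)⁆⁆ = 0
    rw [← hσ' ⁅(w : L), ⁅(x : L), (y : L)⁆⁆, hker]
    intro a
    have := hI x y ⟨⁅(w : L), π a⁆, lie_mem_left ℂ L I _ _ w.2⟩
    rw [← neg_eq_zero, ← hΦinv, hΦ, hψr (hσ' (π a))] at this
    exact this
  have hcenter (x : I) (hx : ∀ w : I, ⁅w, x⁆ = 0) : x = 0 := by
    have : x ∈ center ℂ I := (LieModule.mem_maxTrivSubmodule ℂ I I _).mpr hx
    simpa using this
  rw [eq_bot_iff]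
  exact fun x hx ↦ congrArg Subtype.val
    (hcenter ⟨x, hx⟩ fun y ↦ hcenter _ fun w ↦ hzero w y ⟨x, hx⟩)

end Killing

section Minimal

open LieAlgebra

variable {L : Type*} [LieRing L] [LieAlgebra ℂ L]

/-- A minimal ideal with degenerate Killing form is abelian. -/
theorem lie_self_eq_bot_of_minimal [FiniteDimensional ℂ L] {I : LieIdeal ℂ L}
    (hI : ¬ IsKilling ℂ I) (hmin : ∀ J ≤ I, J ≠ ⊥ → J = I) : ⁅I, I⁆ = ⊥ := by
  have hJ : I ⊓ I.killingCompl ≠ ⊥ := by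
    refine fun h ↦ hI ⟨?_⟩
    rw [eq_bot_iff]
    intro x hx
    rw [LieIdeal.mem_killingCompl] at hx
    have : (x : L) ∈ I ⊓ I.killingCompl := by
      refine ⟨x.2, I.mem_killingCompl.mpr fun y hy ↦ ?_⟩
      have := hx ⟨y, hy⟩ (LieSubmodule.mem_top _)
      rwa [LieIdeal.killingForm_eq] at this
    rw [h] at this
    simpa using this
  have hle : I ≤ I.killingCompl := inf_eq_left.mp (hmin _ inf_le_left hJ)
  have hsolv : IsSolvable I := LieIdeal.isSolvable_of_killingForm_apply_lie_eq_zero I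
    fun x hx y hy ↦ I.mem_killingCompl.mp (hle (LieSubmodule.lie_le_left I I hy)) x hx
  by_contra hne
  have hII : ⁅I, I⁆ = I := hmin _ (LieSubmodule.lie_le_left I I) hne
  obtain ⟨k, hk⟩ := IsSolvable.solvable ℂ I
  rw [LieIdeal.derivedSeries_eq_bot_iff] at hk
  have hconst (n : ℕ) : derivedSeriesOfIdeal ℂ L n I = I := by
    induction n with
    | zero => rfl
    | succ n ih => rw [derivedSeriesOfIdeal_succ, ih, hII]
  rw [hconst] at hk
  exact hne (hII.trans hk)

end Minimal

universe u

/-- The quotient of a Leibniz algebra by an ideal containing all squares is a Lie algebra. -/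
theorem exists_lieAlgebra_quotient {M : Type u} [AddCommGroup M] [Module ℂ M]
    {br : M →ₗ[ℂ] M →ₗ[ℂ] M} (hleib : IsLeftLeibniz br) {R : Submodule ℂ M}
    (hR : IsTwoSidedIdeal br R) (hsq : ∀ a, br a a ∈ R) :
    ∃ (L : Type u) (_ : LieRing L) (_ : LieAlgebra ℂ L) (π : M →ₗ[ℂ] L),
      Function.Surjective π ∧ (∀ a b, π (br a b) = ⁅π a, π b⁆) ∧ ∀ x, π x = 0 ↔ x ∈ R := by
  let bq : M ⧸ R →ₗ[ℂ] M ⧸ R →ₗ[ℂ] M ⧸ R :=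
    R.liftQ ((R.mapQLinear R).comp (br.codRestrict (R.compatibleMaps R) fun a x hx ↦ (hR a x hx).1))
      fun u hu ↦ by
        ext x
        exact (Submodule.Quotient.mk_eq_zero R).mpr (hR x u hu).2
  have hsurj := R.mkQ_surjective
  let lr : LieRing (M ⧸ R) :=
    { bracket := fun x y ↦ bq x y
      add_lie := fun x y z ↦ by simp
      lie_add := fun x y z ↦ by simp
      lie_self := fun x ↦ by
        obtain ⟨a, rfl⟩ := hsurj x
        exact (Submodule.Quotient.mk_eq_zero R).mpr (hsq a)
      leibniz_lie := fun x y z ↦ by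
        obtain ⟨a, rfl⟩ := hsurj x
        obtain ⟨b, rfl⟩ := hsurj y
        obtain ⟨c, rfl⟩ := hsurj z
        exact congrArg R.mkQ (hleib a b c) }
  let la : LieAlgebra ℂ (M ⧸ R) :=
    { (inferInstance : Module ℂ (M ⧸ R)) with
      lie_smul := fun t x y ↦ (bq x).map_smul t y }
  exact ⟨M ⧸ R, lr, la, R.mkQ, hsurj, fun a b ↦ rfl, fun x ↦ Submodule.Quotient.mk_eq_zero R⟩

/-- (Lemma 4.5)  The Lie algebra `M/R` has no nonzero semisimple ideal;
in particular every minimal nonzero ideal of `M/R` is abelian. -/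
theorem quotient_no_semisimple_ideal (M : Type*) [AddCommGroup M] [Module ℂ M]
    [FiniteDimensional ℂ M] (br : M →ₗ[ℂ] M →ₗ[ℂ] M) (hleib : IsLeftLeibniz br)
    (hcent : IsLeftCentral br)
    (R : Submodule ℂ M) (hR : ∀ x : M, x ∈ R ↔ ∀ a : M, br x a + br a x = 0) :
    (∀ A : Submodule ℂ M, IsIdealAbove br R A → IsSemisimpleMod br R A → A = R) ∧
    (∀ A : Submodule ℂ M, IsIdealAbove br R A → R < A →
      (∀ A' : Submodule ℂ M, IsIdealAbove br R A' → A' ≤ A → R < A' → A' = A) →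
      ∀ a ∈ A, ∀ b ∈ A, br a b ∈ R) := by
  have hsymm (a b c : M) : br a (br b c + br c b) = 0 := by
    have h1 := hcent a (b + c)
    have h2 : br a (br b b) = 0 := hcent a b
    have h3 : br a (br c c) = 0 := hcent a c
    simp only [map_add, LinearMap.add_apply, h2, h3] at h1
    simpa [add_comm] using h1
  have hsq0 (a b : M) : br (br a a) b = 0 := by
    simpa using (hleib a a b).symm
  have hsqR (a : M) : br a a ∈ R := by
    rw [hR]
    intro b
    rw [hsq0, hcent, add_zero]
  have hsymR (a b : M) : br a b + br b a ∈ R := by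
    have := R.sub_mem (R.sub_mem (hsqR (a + b)) (hsqR a)) (hsqR b)
    convert this using 1
    simp only [map_add, LinearMap.add_apply]
    abel
  have hRl (m u : M) (hu : u ∈ R) : br m u ∈ R := by
    rw [hR] at hu ⊢
    intro a
    have h1 := hsymm m u a
    have h2 := hu (br m a)
    rw [map_add, hleib m u a, hleib m a u] at h1
    rw [← h1, ← add_zero (br (br m u) a + _), ← h2]
    abel
  have hRideal : IsTwoSidedIdeal br R := fun m u hu ↦ by
    refine ⟨hRl m u hu, ?_⟩
    have := R.sub_mem (hsymR m u) (hRl m u hu)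
    rwa [add_sub_cancel_left] at this
  obtain ⟨L, _, _, π, hsurj, hπ, hker⟩ := exists_lieAlgebra_quotient hleib hRideal hsqR
  have : FiniteDimensional ℂ L := Module.Finite.of_surjective π hsurj
  have hbot (I : LieIdeal ℂ L) (hI : LieAlgebra.IsKilling ℂ I) : I = ⊥ :=
    eq_bot_of_isKilling hleib hcent hsurj hπ (fun x ↦ (hker x).trans (hR x)) I
  have hpre (I : LieIdeal ℂ L) : IsIdealAbove br R (I.toSubmodule.comap π) := by
    refine ⟨fun x hx ↦ ?_, fun m a ha ↦ ?_⟩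
    · simp [(hker x).mpr hx]
    · simp only [Submodule.mem_comap, hπ]
      exact ⟨lie_mem_right ℂ L I _ _ ha, lie_mem_left ℂ L I _ _ ha⟩
  have himage (A : Submodule ℂ M) (hA : IsIdealAbove br R A) :
      ∃ I : LieIdeal ℂ L, ∀ x, π x ∈ I ↔ x ∈ A := by
    refine ⟨{ A.map π with
      lie_mem := ?_ }, fun x ↦ ⟨?_, fun hx ↦ ⟨x, hx, rfl⟩⟩⟩
    · rintro x _ ⟨a, ha, rfl⟩
      obtain ⟨m, rfl⟩ := hsurj x
      exact ⟨br m a, (hA.2 m a ha).1, hπ m a⟩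
    · rintro ⟨a, ha, hax⟩
      have hxa : x - a ∈ R := (hker _).mp (by rw [map_sub, hax, sub_self])
      exact (Submodule.sub_mem_iff_left A ha).mp (hA.1 hxa)
  refine ⟨fun A hA hss ↦ ?_, fun A hA _ hmin a ha b hb ↦ ?_⟩
  · obtain ⟨I, hI⟩ := himage A hA
    have htriv : LieAlgebra.HasTrivialRadical ℂ I := by
      rw [LieAlgebra.hasTrivialRadical_iff_no_abelian_ideals]
      intro J hJ
      have hJR := hss ((J.toSubmodule.map I.toSubmodule.subtype).comap π) ?_ ?_ ?_ ?_
      · rw [eq_bot_iff]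
        intro x hx
        obtain ⟨m, hm⟩ := hsurj (x : L)
        have hmJ : m ∈ (J.toSubmodule.map I.toSubmodule.subtype).comap π := ⟨x, hx, hm.symm⟩
        rw [hJR, ← hker, hm] at hmJ
        exact Subtype.ext hmJ
      · intro x hx
        rw [Submodule.mem_comap, (hker x).mpr hx]
        exact zero_mem _
      · rintro x ⟨y, -, hy⟩
        rw [← hI, ← hy]
        exact y.2
      · rintro l hl x ⟨(y : I), hy, hyx⟩
        have hyx' : (y : L) = π x := hyx
        refine ⟨⟨⁅(⟨π l, (hI l).mpr hl⟩ : I), y⁆, lie_mem_right ℂ I J _ _ hy, ?_⟩,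
          ⟨⁅y, (⟨π l, (hI l).mpr hl⟩ : I)⁆, lie_mem_left ℂ I J _ _ hy, ?_⟩⟩
        · rw [hπ, ← hyx']; rfl
        · rw [hπ, ← hyx']; rfl
      · rintro x ⟨(y : I), hy, hyx⟩ x' ⟨(y' : I), hy', hyx'⟩
        rw [← hker, hπ, ← hyx, ← hyx']
        have := trivial_lie_zero J J ⟨y, hy⟩ ⟨y', hy'⟩
        exact congrArg (fun z : J ↦ ((z : I) : L)) this
    have := hbot I inferInstance
    refine le_antisymm (fun x hx ↦ ?_) hA.1
    rwa [← hI, this, LieSubmodule.mem_bot, hker] at hx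
  · obtain ⟨I, hI⟩ := himage A hA
    have hI0 : ⁅I, I⁆ = ⊥ := by
      by_cases hK : LieAlgebra.IsKilling ℂ I
      · rw [hbot I hK, LieSubmodule.lie_bot]
      refine lie_self_eq_bot_of_minimal hK fun J hJI hJ ↦ le_antisymm hJI fun x hx ↦ ?_
      have hJA := hmin _ (hpre J) (fun m hm ↦ (hI m).mp (hJI hm))
        (lt_of_le_of_ne (hpre J).1 fun h ↦ hJ ?_)
      · obtain ⟨m, rfl⟩ := hsurj x
        rwa [hI, ← hJA] at hx
      · rw [eq_bot_iff]
        intro y hy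
        obtain ⟨m, rfl⟩ := hsurj y
        have hmR : m ∈ R := h ▸ hy
        exact (hker m).mpr hmR
    have := LieSubmodule.lie_mem_lie ((hI a).mpr ha) ((hI b).mpr hb)
    rwa [hI0, ← hπ, LieSubmodule.mem_bot, hker] at this
end

section
/- Let M be a finite-dimensional complex left central Leibniz algebra with radical R, and let B be the subspace with R ⊆ B ⊆ M such that B/R is the solvable radical of the Lie algebra M/R. Then B^⊥ := {x ∈ M : ψ(x,b) = 0 for all b ∈ B} is contained in B. -/
open Submodule

theorem exists_submodule_sl2_cocycle_eq_coboundary {V : Type*} [AddCommGroup V] [Module ℂ V]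
    [FiniteDimensional ℂ V] [Nontrivial V] (X E Y : Module.End ℂ V)
    (hXE : ∀ v, X (E v) = E (X v) + (2 : ℂ) • E v)
    (hXY : ∀ v, X (Y v) = Y (X v) - (2 : ℂ) • Y v)
    (hEY : ∀ v, E (Y v) = Y (E v) + X v)
    (gX gE gY : V →ₗ[ℂ] ℂ)
    (cXE : ∀ v, gX (E v) = gE (X v) + 2 * gE v)
    (cXY : ∀ v, gX (Y v) = gY (X v) - 2 * gY v)
    (cEY : ∀ v, gE (Y v) = gY (E v) + gX v) :
    ∃ A : Submodule ℂ V, A ≠ ⊥ ∧ (∀ v ∈ A, X v ∈ A ∧ E v ∈ A ∧ Y v ∈ A) ∧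
      ∃ ζ : V →ₗ[ℂ] ℂ, ∀ v ∈ A, gX v = ζ (X v) ∧ gE v = ζ (E v) ∧ gY v = ζ (Y v) := by
  let Ω : Module.End ℂ V := X * X + (2 : ℂ) • (E * Y) + (2 : ℂ) • (Y * E)
  have hΩ : ∀ v, Ω v = X (X v) + (2 : ℂ) • E (Y v) + (2 : ℂ) • Y (E v) := fun v => rfl
  let γ : V →ₗ[ℂ] ℂ := gX ∘ₗ X + (2 : ℂ) • (gE ∘ₗ Y) + (2 : ℂ) • (gY ∘ₗ E)
  have hγ : ∀ v, γ v = gX (X v) + 2 * gE (Y v) + 2 * gY (E v) := fun v => rfl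
  have ΩX : ∀ v, Ω (X v) = X (Ω v) := fun v => by
    simp only [hΩ, map_add, map_sub, map_smul, hXE, hXY]; module
  have ΩE : ∀ v, Ω (E v) = E (Ω v) := fun v => by
    simp only [hΩ, map_add, map_smul, hXE, hEY]; module
  have ΩY : ∀ v, Ω (Y v) = Y (Ω v) := fun v => by
    simp only [hΩ, map_add, map_sub, map_smul, hXY, hEY]; module
  have γX : ∀ v, γ (X v) = gX (Ω v) := fun v => by
    simp only [hΩ, hγ, map_add, map_sub, map_smul, smul_eq_mul, cXE, cXY, hXE, hXY]; ring
  have γE : ∀ v, γ (E v) = gE (Ω v) := fun v => by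
    have h1 := cXE (X v)
    have h2 := cEY (E v)
    simp only [hΩ, hγ, map_add, map_smul, smul_eq_mul, hXE, hEY] at h1 h2 ⊢
    linear_combination h1 - 2 * h2
  have γY : ∀ v, γ (Y v) = gY (Ω v) := fun v => by
    simp only [hΩ, hγ, map_add, map_sub, map_smul, smul_eq_mul, cXY, cEY, hXY, hEY]; ring
  obtain ⟨μ, hμ⟩ := Module.End.exists_eigenvalue Ω
  have hker : ∀ v ∈ Ω.eigenspace μ,
      X v ∈ Ω.eigenspace μ ∧ E v ∈ Ω.eigenspace μ ∧ Y v ∈ Ω.eigenspace μ := by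
    intro v hv
    simp only [Module.End.mem_eigenspace_iff] at hv ⊢
    simp [ΩX, ΩE, ΩY, hv]
  rcases ne_or_eq μ 0 with h0 | rfl
  · refine ⟨Ω.eigenspace μ, hμ, hker, μ⁻¹ • γ, fun v hv => ?_⟩
    rw [Module.End.mem_eigenspace_iff] at hv
    simp [γX, γE, γY, hv, h0]
  by_cases hX : X = 0
  · have hE : ∀ v, E v = 0 := fun v => by simpa [hX] using (hXE v).symm
    have hY : ∀ v, Y v = 0 := fun v => by simpa [hX] using (hXY v).symm
    have hgX : ∀ v, gX v = 0 := fun v => by simpa [hE, hY] using (cEY v).symm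
    refine ⟨⊤, top_ne_bot, by simp, 0, fun v _ => ?_⟩
    have h1 := cXE v
    have h2 := cXY v
    simp_all
  let _ : LieRing (Module.End ℂ V) := LieRing.ofAssociativeRing
  have ht : IsSl2Triple X E Y :=
    { h_ne_zero := hX
      lie_e_f := by ext v; simp [Ring.lie_def, hEY]
      lie_h_e_nsmul := by ext v; simp [Ring.lie_def, hXE, two_smul]
      lie_h_f_nsmul := by ext v; simp [Ring.lie_def, hXY, two_smul] }
  obtain ⟨v, μ, hv0, hvΩ, hvX, hvE⟩ :
      ∃ (v : V) (μ : ℂ), v ≠ 0 ∧ Ω v = 0 ∧ X v = μ • v ∧ E v = 0 := by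
    have hX' : ∀ v ∈ Ω.eigenspace 0, X v ∈ Ω.eigenspace 0 := fun v hv => (hker v hv).1
    let X' : Module.End ℂ (Ω.eigenspace 0) := X.restrict hX'
    have : Nontrivial (Ω.eigenspace 0) := Submodule.nontrivial_iff_ne_bot.mpr hμ
    have hfin : {μ : ℂ | X'.HasEigenvalue μ}.Finite := X'.finite_hasEigenvalue
    obtain ⟨ν, hν⟩ := Module.End.exists_eigenvalue X'
    obtain ⟨μ, hμ1, hμ2⟩ := hfin.exists_maximalFor Complex.re _ ⟨ν, hν⟩
    obtain ⟨w, hw⟩ := hμ1.exists_hasEigenvector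
    have hwX : X w = μ • (w : V) := congrArg Subtype.val hw.apply_eq_smul
    refine ⟨w, μ, by simpa using hw.2, by simpa using w.2, hwX, ?_⟩
    by_contra hne
    have : X'.HasEigenvalue (μ + 2) := by
      refine Module.End.hasEigenvalue_of_hasEigenvector (x := ⟨E w, (hker w w.2).2.1⟩) ⟨?_, ?_⟩
      · rw [Module.End.mem_eigenspace_iff]
        ext
        change X (E w) = (μ + 2) • E w
        rw [hXE, hwX, map_smul, add_smul]
      · simpa [Subtype.ext_iff] using hne
    have := hμ2 this (by simp)
    simp at this
    linarith
  have hP : ht.HasPrimitiveVectorWith v μ := ⟨hv0, hvX, hvE⟩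
  obtain ⟨n, rfl⟩ := hP.exists_nat
  have hn : n = 0 := by
    have h1 : ((n : ℂ) * n + 2 * n) • v = 0 := by
      rw [← hvΩ, hΩ, hEY, hvE, hvX]; simp only [map_smul, hvX, map_zero]; module
    have h2 := (smul_eq_zero.mp h1).resolve_right hv0
    norm_cast at h2
    nlinarith
  subst hn
  have hvY : Y v = 0 := by simpa using hP.pow_toEnd_f_eq_zero_of_eq_nat rfl
  have hvX : X v = 0 := by simpa using hvX
  have hgX : gX v = 0 := by simpa [hvE, hvY] using (cEY v).symm
  have hgE : gE v = 0 := by simpa [hvE, hvX] using (cXE v).symm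
  have hgY : gY v = 0 := by simpa [hvY, hvX] using (cXY v).symm
  refine ⟨ℂ ∙ v, by simpa using hv0, ?_, 0, ?_⟩
  · intro w hw
    obtain ⟨c, rfl⟩ := Submodule.mem_span_singleton.mp hw
    simp [hvX, hvE, hvY]
  · intro w hw
    obtain ⟨c, rfl⟩ := Submodule.mem_span_singleton.mp hw
    simp [hgX, hgE, hgY]

/-- A bilinear map vanishing against `C` on both sides descends to the quotient by `C`. -/
theorem exists_lift_quotient {V N : Type*} [AddCommGroup V] [Module ℂ V] [AddCommGroup N]
    [Module ℂ N] (C : Submodule ℂ V) (g : V →ₗ[ℂ] V →ₗ[ℂ] N) (h1 : ∀ c ∈ C, ∀ a, g c a = 0)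
    (h2 : ∀ c ∈ C, ∀ a, g a c = 0) :
    ∃ g' : (V ⧸ C) →ₗ[ℂ] (V ⧸ C) →ₗ[ℂ] N, ∀ a b, g' (C.mkQ a) (C.mkQ b) = g a b := by
  let k : V →ₗ[ℂ] (V ⧸ C) →ₗ[ℂ] N :=
    { toFun := fun a => C.liftQ (g a) (fun b hb => h2 b hb a)
      map_add' := fun a b => by
        ext x
        exact LinearMap.congr_fun (map_add g a b) x
      map_smul' := fun c a => by
        ext x
        exact LinearMap.congr_fun (map_smul g c a) x }
  exact ⟨C.liftQ k (fun a ha => by ext b; exact h1 a ha b), fun a b => rfl⟩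

/-- A bilinear form `f` on a Lie algebra which is a `1`-cocycle with values in the coadjoint
module. -/
def IsLeibnizCocycle {L : Type*} [LieRing L] [LieAlgebra ℂ L] (f : L →ₗ[ℂ] L →ₗ[ℂ] ℂ) : Prop :=
  ∀ a b c : L, f a ⁅b, c⁆ = f ⁅a, b⁆ c + f b ⁅a, c⁆

namespace IsLeibnizCocycle

variable {L : Type*} [LieRing L] [LieAlgebra ℂ L] {f : L →ₗ[ℂ] L →ₗ[ℂ] ℂ}

theorem symm_invariant (hf : IsLeibnizCocycle f) (a b c : L) :
    f ⁅a, b⁆ c + f c ⁅a, b⁆ + (f b ⁅a, c⁆ + f ⁅a, c⁆ b) = 0 := by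
  have h1 := hf a b c
  have h2 := hf a c b
  have h3 : f a ⁅b, c⁆ + f a ⁅c, b⁆ = 0 := by rw [← map_add, ← lie_skew, neg_add_cancel, map_zero]
  linear_combination h3 - h1 - h2

/-- The pullback of a cocycle along a Lie algebra homomorphism. -/
theorem comp {L' : Type*} [LieRing L'] [LieAlgebra ℂ L'] (hf : IsLeibnizCocycle f)
    (g : L' →ₗ⁅ℂ⁆ L) :
    IsLeibnizCocycle (f.compl₁₂ (g : L' →ₗ[ℂ] L) (g : L' →ₗ[ℂ] L)) := fun a b c => by
  simpa using hf (g a) (g b) (g c)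

/-- Subtracting a coboundary. -/
theorem sub_coboundary (hf : IsLeibnizCocycle f) (ζ : L →ₗ[ℂ] ℂ) :
    ∃ f' : L →ₗ[ℂ] L →ₗ[ℂ] ℂ, IsLeibnizCocycle f' ∧ ∀ a b, f' a b = f a b - ζ ⁅a, b⁆ := by
  let f' := f - (LieModule.toEnd ℂ L L : L →ₗ[ℂ] Module.End ℂ L).compr₂ ζ
  have h : ∀ a b, f' a b = f a b - ζ ⁅a, b⁆ := fun a b => rfl
  refine ⟨f', fun a b c => ?_, h⟩
  simp only [h]
  rw [hf a b c, leibniz_lie a b c, map_add]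
  ring

/-- A cocycle vanishing against an ideal on both sides descends to the quotient. -/
theorem exists_quotient (hf : IsLeibnizCocycle f) (A : LieIdeal ℂ L)
    (h1 : ∀ a ∈ A, ∀ b, f a b = 0) (h2 : ∀ a ∈ A, ∀ b, f b a = 0) :
    ∃ f' : (L ⧸ A) →ₗ[ℂ] (L ⧸ A) →ₗ[ℂ] ℂ, IsLeibnizCocycle f' ∧
      ∀ a b : L, f' (LieSubmodule.Quotient.mk a) (LieSubmodule.Quotient.mk b) = f a b := by
  obtain ⟨f', h⟩ := exists_lift_quotient A.toSubmodule f h1 h2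
  have h : ∀ a b : L, f' (LieSubmodule.Quotient.mk a) (LieSubmodule.Quotient.mk b) = f a b := h
  refine ⟨f', fun a b c => ?_, h⟩
  obtain ⟨a, rfl⟩ := LieSubmodule.Quotient.surjective_mk' A a
  obtain ⟨b, rfl⟩ := LieSubmodule.Quotient.surjective_mk' A b
  obtain ⟨c, rfl⟩ := LieSubmodule.Quotient.surjective_mk' A c
  simp only [LieSubmodule.Quotient.mk'_apply, ← LieSubmodule.Quotient.mk_bracket, h]
  exact hf a b c

end IsLeibnizCocycle

/-- Elements of an ideal `N` all of whose Engel subalgebras are everything form a nilpotent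
ideal, so a nonzero such `N` has nonzero centre. -/
theorem exists_ne_zero_forall_lie_eq_zero {L : Type*} [LieRing L] [LieAlgebra ℂ L]
    [FiniteDimensional ℂ L] (N : LieIdeal ℂ L) (hN : N ≠ ⊥)
    (h : ∀ n ∈ N, LieSubalgebra.engel ℂ n = ⊤) : ∃ w ∈ N, w ≠ 0 ∧ ∀ n ∈ N, ⁅n, w⁆ = 0 := by
  have hnil : LieModule.IsNilpotent N N := by
    change LieRing.IsNilpotent N
    rw [LieAlgebra.isNilpotent_iff_forall (R := ℂ)]
    rintro ⟨n, hn⟩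
    refine LieSubalgebra.isNilpotent_ad_of_isNilpotent_ad (R := ℂ) (N : LieSubalgebra ℂ L)
      (x := ⟨n, hn⟩) ?_
    rw [Module.End.isNilpotent_iff_of_finite]
    intro m
    have : m ∈ LieSubalgebra.engel ℂ n := by rw [h n hn]; trivial
    exact (LieSubalgebra.mem_engel_iff ℂ n m).mp this
  have : Nontrivial N := (LieSubmodule.nontrivial_iff_ne_bot ℂ L L).mpr hN
  have := LieModule.nontrivial_max_triv_of_isNilpotent ℂ N N
  obtain ⟨w, hw⟩ := exists_ne (0 : LieModule.maxTrivSubmodule ℂ N N)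
  refine ⟨w, w.1.2, fun h0 => hw (Subtype.ext (Subtype.ext h0)), fun n hn => ?_⟩
  exact congrArg Subtype.val (w.2 ⟨n, hn⟩)

/-- The Engel subalgebra of an element of an ideal `N`, together with `N`, spans everything. -/
theorem engel_sup_eq_top {L : Type*} [LieRing L] [LieAlgebra ℂ L]
    [FiniteDimensional ℂ L] (N : LieIdeal ℂ L) {n : L} (hn : n ∈ N) (a : L) :
    ∃ b ∈ LieSubalgebra.engel ℂ n, a - b ∈ N := by
  have hc := (LieAlgebra.ad ℂ L n).isCompl_iSup_ker_pow_iInf_range_pow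
  obtain ⟨b, hb, c, hc, rfl⟩ := Submodule.mem_sup.mp (hc.sup_eq_top ▸ Submodule.mem_top : a ∈ _)
  refine ⟨b, ?_, ?_⟩
  · rw [LieSubalgebra.mem_engel_iff]
    rw [Submodule.mem_iSup_of_directed] at hb
    · simpa using hb
    · exact ((LieAlgebra.ad ℂ L n).iterateKer.monotone).directed_le
  · rw [Submodule.mem_iInf] at hc
    obtain ⟨d, hd⟩ := hc 1
    rw [add_sub_cancel_left, ← hd]
    simpa using lie_mem_left ℂ L N n d hn

/-- Every Leibniz cocycle vanishes on the semisimple element of an `sl₂`-triple modulo an ideal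
`N` contained in the kernel of its symmetrisation. -/
def VanishesOnSl2 (L : Type*) [LieRing L] [LieAlgebra ℂ L] : Prop :=
  ∀ f : L →ₗ[ℂ] L →ₗ[ℂ] ℂ, IsLeibnizCocycle f →
    ∀ N : LieIdeal ℂ L, (∀ n ∈ N, ∀ a, f n a + f a n = 0) →
      ∀ x e y : L, ⁅x, e⁆ - (2 : ℂ) • e ∈ N → ⁅x, y⁆ + (2 : ℂ) • y ∈ N → ⁅e, y⁆ - x ∈ N →
        f x x = 0

section

variable {L : Type*} [LieRing L] [LieAlgebra ℂ L] {f : L →ₗ[ℂ] L →ₗ[ℂ] ℂ}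

theorem VanishesOnSl2.apply_self_of_subalgebra {P : LieSubalgebra ℂ L} (hP : VanishesOnSl2 P)
    (hf : IsLeibnizCocycle f) (N : LieIdeal ℂ L) (hN : ∀ n ∈ N, ∀ a, f n a + f a n = 0)
    {x e y : L} (hxe : ⁅x, e⁆ - (2 : ℂ) • e ∈ N) (hxy : ⁅x, y⁆ + (2 : ℂ) • y ∈ N)
    (hey : ⁅e, y⁆ - x ∈ N) (hx : ∃ b ∈ P, x - b ∈ N) (he : ∃ b ∈ P, e - b ∈ N)
    (hy : ∃ b ∈ P, y - b ∈ N) : f x x = 0 := by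
  obtain ⟨x', hx', hx⟩ := hx
  obtain ⟨e', he', he⟩ := he
  obtain ⟨y', hy', hy⟩ := hy
  have key : ∀ {a a' b b' : L}, a - a' ∈ N → b - b' ∈ N → ⁅a, b⁆ - ⁅a', b'⁆ ∈ N := by
    intro a a' b b' ha hb
    have : ⁅a, b⁆ - ⁅a', b'⁆ = ⁅a - a', b⁆ + ⁅a', b - b'⁆ := by
      simp only [sub_lie, lie_sub]; abel
    rw [this]
    exact add_mem (lie_mem_left ℂ L N _ _ ha) (lie_mem_right ℂ L N _ _ hb)
  have h := hP _ (hf.comp P.incl) (N.comap P.incl) (fun n hn a => hN n hn a)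
    ⟨x', hx'⟩ ⟨e', he'⟩ ⟨y', hy'⟩
    (by
      change ⁅x', e'⁆ - (2 : ℂ) • e' ∈ N
      have := add_mem (sub_mem hxe (key hx he)) (N.smul_mem (2 : ℂ) he)
      convert this using 1
      module)
    (by
      change ⁅x', y'⁆ + (2 : ℂ) • y' ∈ N
      have := sub_mem (sub_mem hxy (key hx hy)) (N.smul_mem (2 : ℂ) hy)
      convert this using 1
      module)
    (by
      change ⁅e', y'⁆ - x' ∈ N
      have := add_mem (sub_mem hey (key he hy)) hx
      convert this using 1
      abel)
  have h' : f x' x' = 0 := h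
  have h1 := hN _ hx x
  have h2 := hN _ hx x'
  simp only [map_sub, LinearMap.sub_apply] at h1 h2
  linear_combination (1 / 2 : ℂ) * (h1 + h2) + h'

theorem VanishesOnSl2.apply_self_of_quotient {A : LieIdeal ℂ L} (hA : VanishesOnSl2 (L ⧸ A))
    (hf : IsLeibnizCocycle f) (N : LieIdeal ℂ L) (hN : ∀ n ∈ N, ∀ a, f n a + f a n = 0)
    {x e y : L} (hxe : ⁅x, e⁆ - (2 : ℂ) • e ∈ N) (hxy : ⁅x, y⁆ + (2 : ℂ) • y ∈ N)
    (hey : ⁅e, y⁆ - x ∈ N) (hAN : A ≤ N) (ζ : L →ₗ[ℂ] ℂ) (hζ : ∀ a, ∀ z ∈ A, f a z = ζ ⁅a, z⁆) :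
    f x x = 0 := by
  obtain ⟨f', hf', h'⟩ := hf.sub_coboundary ζ
  have hs : ∀ a b, f' a b + f' b a = f a b + f b a := fun a b => by
    rw [h', h', ← lie_skew a b, map_neg]; ring
  have h2 : ∀ a ∈ A, ∀ b, f' b a = 0 := fun a ha b => by rw [h', hζ b a ha, sub_self]
  have h1 : ∀ a ∈ A, ∀ b, f' a b = 0 := fun a ha b => by
    have := hs a b
    rwa [h2 a ha, add_zero, hN a (hAN ha) b] at this
  obtain ⟨g, hg, hgf⟩ := hf'.exists_quotient A h1 h2
  let π : L →ₗ⁅ℂ⁆ L ⧸ A := 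
    { (LieSubmodule.Quotient.mk' A : L →ₗ[ℂ] L ⧸ A) with map_lie' := fun {_ _} => rfl }
  have hπ : Function.Surjective π := LieSubmodule.Quotient.surjective_mk' A
  have hmem : ∀ n ∈ N, π n ∈ N.map π := fun n hn => LieIdeal.mem_map hn
  have := hA g hg (N.map π) (fun n hn a => ?_) (π x) (π e) (π y)
    (by simpa using hmem _ hxe) (by simpa using hmem _ hxy) (by simpa using hmem _ hey)
  · have h0 : f' x x = 0 := by rw [← hgf]; exact this
    have := hs x x
    rw [h0] at this
    linear_combination (-1 / 2 : ℂ) * this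
  · obtain ⟨⟨n, hn'⟩, rfl⟩ := LieIdeal.mem_map_of_surjective hπ hn
    obtain ⟨a, rfl⟩ := hπ a
    change g (LieSubmodule.Quotient.mk n) (LieSubmodule.Quotient.mk a)
      + g (LieSubmodule.Quotient.mk a) (LieSubmodule.Quotient.mk n) = 0
    rw [hgf, hgf, hs, hN n hn' a]

end

/-- The elements of an ideal `N` annihilated by `N` under both the bracket and the cocycle. -/
def IsLeibnizCocycle.centerIdeal {L : Type*} [LieRing L] [LieAlgebra ℂ L]
    {f : L →ₗ[ℂ] L →ₗ[ℂ] ℂ} (hf : IsLeibnizCocycle f) (N : LieIdeal ℂ L) : LieIdeal ℂ L where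
  carrier := {z | z ∈ N ∧ ∀ n ∈ N, ⁅n, z⁆ = 0 ∧ f n z = 0}
  zero_mem' := ⟨N.zero_mem, fun n _ => ⟨lie_zero n, map_zero _⟩⟩
  add_mem' := fun ha hb => ⟨N.add_mem ha.1 hb.1, fun n hn => by
    rw [lie_add, map_add, (ha.2 n hn).1, (ha.2 n hn).2, (hb.2 n hn).1, (hb.2 n hn).2]
    simp⟩
  smul_mem' := fun c a ha => ⟨N.smul_mem c ha.1, fun n hn => by
    rw [lie_smul, map_smul, (ha.2 n hn).1, (ha.2 n hn).2]
    simp⟩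
  lie_mem := fun {a z} hz => ⟨lie_mem_right ℂ L N a z hz.1, fun n hn => by
    have h := hz.2 _ (lie_mem_left ℂ L N n a hn)
    rw [leibniz_lie, hf, h.1, h.2, (hz.2 n hn).1]
    simp⟩

theorem isLeibnizCocycle_zero {L : Type*} [LieRing L] [LieAlgebra ℂ L] :
    IsLeibnizCocycle (0 : L →ₗ[ℂ] L →ₗ[ℂ] ℂ) := fun a b c => by simp

/-- The subalgebra `N + ⟨x, e, y⟩` for an `sl₂`-triple modulo `N`. -/
def sl2SupSubalgebra {L : Type*} [LieRing L] [LieAlgebra ℂ L] (N : LieIdeal ℂ L) {x e y : L}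
    (hxe : ⁅x, e⁆ - (2 : ℂ) • e ∈ N) (hxy : ⁅x, y⁆ + (2 : ℂ) • y ∈ N)
    (hey : ⁅e, y⁆ - x ∈ N) : LieSubalgebra ℂ L where
  carrier := {a | ∃ α β γ : ℂ, a - (α • x + β • e + γ • y) ∈ N}
  zero_mem' := ⟨0, 0, 0, by simp⟩
  add_mem' := by
    rintro a b ⟨α, β, γ, h⟩ ⟨α', β', γ', h'⟩
    refine ⟨α + α', β + β', γ + γ', ?_⟩
    have h1 : _ ∈ N := add_mem h h'
    convert h1 using 1
    module
  smul_mem' := by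
    rintro c a ⟨α, β, γ, h⟩
    refine ⟨c * α, c * β, c * γ, ?_⟩
    have h1 : _ ∈ N := N.smul_mem c h
    convert h1 using 1
    module
  lie_mem' := by
    rintro a b ⟨α, β, γ, h⟩ ⟨α', β', γ', h'⟩
    refine ⟨β * γ' - γ * β', 2 * (α * β' - β * α'), -2 * (α * γ' - γ * α'), ?_⟩
    have h1 := lie_mem_left ℂ L N _ b h
    have h2 := lie_mem_right ℂ L N (α • x + β • e + γ • y) _ h'
    have h3 : _ ∈ N := add_mem (add_mem (N.smul_mem (α * β' - β * α') hxe)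
      (N.smul_mem (α * γ' - γ * α') hxy)) (N.smul_mem (β * γ' - γ * β') hey)
    have h4 : _ ∈ N := add_mem (add_mem h1 h2) h3
    convert h4 using 1
    have e1 : ⁅e, x⁆ = -⁅x, e⁆ := (lie_skew _ _).symm
    have e2 : ⁅y, x⁆ = -⁅x, y⁆ := (lie_skew _ _).symm
    have e3 : ⁅y, e⁆ = -⁅e, y⁆ := (lie_skew _ _).symm
    simp only [sub_lie, lie_sub, add_lie, lie_add, smul_lie, lie_smul, lie_self, e1, e2, e3]
    module

theorem vanishesOnSl2_of_finrank_eq : ∀ (d : ℕ) (L : Type*) [LieRing L] [LieAlgebra ℂ L]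
    [FiniteDimensional ℂ L], Module.finrank ℂ L = d → VanishesOnSl2 L := by
  intro d
  induction d using Nat.strong_induction_on with
  | _ d ih =>
  intro L _ _ _ hd f hf N hN x e y hxe hxy hey
  by_contra hne
  have hsub : ∀ P : LieSubalgebra ℂ L, (∃ b ∈ P, x - b ∈ N) → (∃ b ∈ P, e - b ∈ N) →
      (∃ b ∈ P, y - b ∈ N) → P = ⊤ := by
    intro P hx he hy
    by_contra hP
    have hlt : Module.finrank ℂ P < d := by
      rw [← hd]
      refine Submodule.finrank_lt (s := P.toSubmodule) ?_
      rwa [Ne, LieSubalgebra.toSubmodule_eq_top]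
    exact hne ((ih _ hlt P rfl).apply_self_of_subalgebra hf N hN hxe hxy hey hx he hy)
  have hsub' : ∀ P : LieSubalgebra ℂ L, (∀ a, ∃ b ∈ P, a - b ∈ N) → P = ⊤ :=
    fun P hP => hsub P (hP x) (hP e) (hP y)
  have hspan : ∀ a, ∃ α β γ : ℂ, a - (α • x + β • e + γ • y) ∈ N := by
    intro a
    have hP := hsub (sl2SupSubalgebra N hxe hxy hey) ⟨x, ⟨1, 0, 0, by simp⟩, by simp⟩
      ⟨e, ⟨0, 1, 0, by simp⟩, by simp⟩ ⟨y, ⟨0, 0, 1, by simp⟩, by simp⟩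
    have : a ∈ sl2SupSubalgebra N hxe hxy hey := hP ▸ LieSubalgebra.mem_top a
    exact this
  have hengel : ∀ n ∈ N, LieSubalgebra.engel ℂ n = ⊤ := fun n hn =>
    hsub' _ (engel_sup_eq_top N hn)
  have hZ : hf.centerIdeal N = ⊥ := by
    by_contra hZ
    let Z := hf.centerIdeal N
    have hZmem : ∀ z : Z, (z : L) ∈ N ∧ ∀ n ∈ N, ⁅n, (z : L)⁆ = 0 ∧ f n z = 0 := fun z => z.2
    have : Nontrivial Z := (LieSubmodule.nontrivial_iff_ne_bot ℂ L L).mpr hZ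
    let ρ : L → Module.End ℂ Z := fun a => LieModule.toEnd ℂ L Z a
    have hρ : ∀ a (z : Z), ((ρ a z : Z) : L) = ⁅a, (z : L)⁆ := fun a z => rfl
    let g : L → Z →ₗ[ℂ] ℂ := fun a => (f a).comp Z.toSubmodule.subtype
    have hg : ∀ a (z : Z), g a z = f a z := fun a z => rfl
    obtain ⟨A, hA, hAinv, ζ, hζ⟩ := exists_submodule_sl2_cocycle_eq_coboundary (ρ x) (ρ e) (ρ y)
      (fun v => Subtype.ext (by
        have := ((hZmem v).2 _ hxe).1
        simp only [hρ, LieSubmodule.coe_add, LieSubmodule.coe_smul]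
        rw [leibniz_lie, add_comm, add_right_inj, ← sub_eq_zero, ← this, sub_lie, smul_lie]))
      (fun v => Subtype.ext (by
        have := ((hZmem v).2 _ hxy).1
        simp only [hρ, LieSubmodule.coe_sub, LieSubmodule.coe_smul]
        rw [leibniz_lie, add_comm, sub_eq_add_neg, add_right_inj, ← sub_eq_zero, ← this, add_lie,
          smul_lie, sub_neg_eq_add]))
      (fun v => Subtype.ext (by
        have := ((hZmem v).2 _ hey).1
        simp only [hρ, LieSubmodule.coe_add]
        rw [leibniz_lie, add_comm, add_right_inj, ← sub_eq_zero, ← this, sub_lie]))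
      (g x) (g e) (g y)
      (fun v => by
        have := ((hZmem v).2 _ hxe).2
        simp only [map_sub, map_smul, LinearMap.sub_apply, LinearMap.smul_apply, smul_eq_mul]
          at this
        simp only [hg, hρ]
        rw [hf]
        linear_combination this)
      (fun v => by
        have := ((hZmem v).2 _ hxy).2
        simp only [map_add, map_smul, LinearMap.add_apply, LinearMap.smul_apply, smul_eq_mul]
          at this
        simp only [hg, hρ]
        rw [hf]
        linear_combination this)
      (fun v => by
        have := ((hZmem v).2 _ hey).2
        simp only [map_sub, LinearMap.sub_apply] at this
        simp only [hg, hρ]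
        rw [hf]
        linear_combination this)
    obtain ⟨ζ', hζ'⟩ := LinearMap.exists_extend ζ
    have hζ'' : ∀ z : Z, ζ' z = ζ z := fun z => LinearMap.congr_fun hζ' z
    have hlie : ∀ a, ∃ α β γ : ℂ, ∀ z : Z, ρ a z = α • ρ x z + β • ρ e z + γ • ρ y z ∧
        f a z = α * f x z + β * f e z + γ * f y z := by
      intro a
      obtain ⟨α, β, γ, h⟩ := hspan a
      refine ⟨α, β, γ, fun z => ⟨Subtype.ext ?_, ?_⟩⟩
      · have := ((hZmem z).2 _ h).1
        simp only [sub_lie, add_lie, smul_lie, sub_eq_zero] at this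
        exact this
      · have := ((hZmem z).2 _ h).2
        simpa only [map_sub, map_add, map_smul, LinearMap.sub_apply, LinearMap.add_apply,
          LinearMap.smul_apply, smul_eq_mul, sub_eq_zero] using this
    let A' : LieIdeal ℂ L :=
      { A.map Z.toSubmodule.subtype with
        lie_mem := by
          rintro a _ ⟨z, hz, rfl⟩
          obtain ⟨α, β, γ, h⟩ := hlie a
          refine ⟨ρ a z, ?_, rfl⟩
          have h3 := hAinv z hz
          rw [(h z).1]
          exact A.add_mem (A.add_mem (A.smul_mem _ h3.1) (A.smul_mem _ h3.2.1))
            (A.smul_mem _ h3.2.2) }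
    have hA'mem : ∀ a, a ∈ A' ↔ ∃ z ∈ A, (z : L) = a := fun a => Iff.rfl
    have hlt : Module.finrank ℂ (L ⧸ A') < d := by
      have h1 := Submodule.finrank_quotient_add_finrank A'.toSubmodule
      have h2 : A'.toSubmodule ≠ ⊥ := fun h0 => hA <| by
        rw [eq_bot_iff]
        intro z hz
        have : (z : L) ∈ A'.toSubmodule := ⟨z, hz, rfl⟩
        rw [h0] at this
        exact Subtype.ext this
      have h3 := Submodule.one_le_finrank_iff.mpr h2
      have h4 : Module.finrank ℂ (L ⧸ A') = Module.finrank ℂ (L ⧸ A'.toSubmodule) := rfl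
      omega
    refine hne ((ih _ hlt (L ⧸ A') rfl).apply_self_of_quotient hf N hN hxe hxy hey ?_ ζ' ?_)
    · intro a ha
      obtain ⟨z, _, rfl⟩ := (hA'mem a).mp ha
      exact (hZmem z).1
    · intro a z hz
      obtain ⟨z, hzA, rfl⟩ := (hA'mem z).mp hz
      obtain ⟨α, β, γ, h⟩ := hlie a
      rw [← hρ, hζ'', (h z).1, (h z).2]
      have h3 := hζ z hzA
      simp only [hg] at h3
      simp only [map_add, map_smul, smul_eq_mul, h3]
  have hNbot : N = ⊥ := by
    by_contra hNne
    let W := isLeibnizCocycle_zero.centerIdeal (L := L) N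
    have hWmem : ∀ w, w ∈ W ↔ w ∈ N ∧ ∀ n ∈ N, ⁅n, w⁆ = 0 := fun w => by
      change (w ∈ N ∧ ∀ n ∈ N, ⁅n, w⁆ = 0 ∧ (0 : ℂ) = 0) ↔ _
      simp
    have hZmem : ∀ w ∈ W, (∀ n ∈ N, f n w = 0) → w = 0 := by
      intro w hw h
      have : w ∈ hf.centerIdeal N :=
        ⟨((hWmem w).mp hw).1, fun n hn => ⟨((hWmem w).mp hw).2 n hn, h n hn⟩⟩
      rw [hZ] at this
      exact this
    let b : N →ₗ[ℂ] W →ₗ[ℂ] ℂ := f.compl₁₂ N.toSubmodule.subtype W.toSubmodule.subtype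
    have hb : ∀ n w, b n w = f n w := fun n w => rfl
    have hsurj : Function.Surjective b := by
      rw [← LinearMap.flip_injective_iff₁, injective_iff_map_eq_zero]
      intro w hw
      exact Subtype.ext (hZmem w w.2 fun n hn => LinearMap.congr_fun hw ⟨n, hn⟩)
    let P : LieSubalgebra ℂ L :=
      { carrier := {a | ∀ w ∈ W, f a w = 0}
        zero_mem' := fun w _ => by simp
        add_mem' := fun {a b} ha hb w hw => by simp [ha w hw, hb w hw]
        smul_mem' := fun c a ha w hw => by simp [ha w hw]
        lie_mem' := fun {a b} ha hb w hw => by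
          have := hf a b w
          rw [ha _ (lie_mem_right ℂ L W b w hw), hb _ (lie_mem_right ℂ L W a w hw)] at this
          simpa using this.symm }
    have hP : P = ⊤ := by
      refine hsub' P fun a => ?_
      obtain ⟨n, hn⟩ := hsurj ((f a).comp W.toSubmodule.subtype)
      refine ⟨a - n, fun w hw => ?_, by simp⟩
      have : f n w = f a w := LinearMap.congr_fun hn ⟨w, hw⟩
      simp [this]
    obtain ⟨w, hwN, hw0, hw⟩ := exists_ne_zero_forall_lie_eq_zero N hNne hengel
    have hwW : w ∈ W := (hWmem w).mpr ⟨hwN, hw⟩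
    refine hw0 (hZmem w hwW fun n _ => ?_)
    have : n ∈ P := hP ▸ LieSubalgebra.mem_top n
    exact this w hwW
  subst hNbot
  rw [LieSubmodule.mem_bot] at hxe hxy hey
  rw [sub_eq_zero] at hxe hey
  rw [add_eq_zero_iff_eq_neg] at hxy
  refine hne ?_
  have h := hf x e y
  rw [hxe, hxy, hey] at h
  simpa using h

theorem vanishesOnSl2 (L : Type*) [LieRing L] [LieAlgebra ℂ L] [FiniteDimensional ℂ L] :
    VanishesOnSl2 L :=
  vanishesOnSl2_of_finrank_eq _ L rfl

section

open LieAlgebra LieModule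

/-- An invariant bilinear form on a simple Lie algebra which vanishes on `(h, h)` for every
`sl₂`-triple `(h, e, f)` is zero. -/
theorem eq_zero_of_invariant_of_isSl2Triple {S : Type*} [LieRing S] [LieAlgebra ℂ S]
    [FiniteDimensional ℂ S] [IsSimple ℂ S] (Φ : S →ₗ[ℂ] S →ₗ[ℂ] ℂ)
    (hinv : ∀ a b c : S, Φ ⁅a, b⁆ c + Φ b ⁅a, c⁆ = 0)
    (hsl2 : ∀ h e f : S, IsSl2Triple h e f → Φ h h = 0) : Φ = 0 := by
  obtain ⟨z, hz⟩ := LieAlgebra.exists_isCartanSubalgebra_engel ℂ S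
  let H := LieSubalgebra.engel ℂ z
  have : H.IsCartanSubalgebra := hz
  have hroot0 : ∀ t ∈ rootSpace H (0 : H → ℂ), t ∈ H := fun t ht => by
    rw [rootSpace_zero_eq] at ht
    exact ht
  have htop := iSup_genWeightSpace_eq_top' ℂ H S
  obtain ⟨α, hα⟩ : ∃ α : Weight ℂ H S, α.IsNonZero := by
    by_contra! hno
    have hle : (⊤ : LieSubmodule ℂ H S) ≤ H.toLieSubmodule := by
      rw [← htop, iSup_le_iff]
      intro α t ht
      have h0 : (α : H → ℂ) = 0 := hno α
      rw [h0] at ht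
      exact hroot0 t ht
    refine IsSimple.non_abelian (R := ℂ) (L := S) ⟨fun a b => ?_⟩
    have ha : a ∈ H := hle (LieSubmodule.mem_top a)
    have hb : b ∈ H := hle (LieSubmodule.mem_top b)
    exact congrArg Subtype.val (trivial_lie_zero H H ⟨a, ha⟩ ⟨b, hb⟩)
  obtain ⟨h, e, f, ht, he, hf⟩ := IsKilling.exists_isSl2Triple_of_weight_isNonZero hα
  have hhH : h ∈ H := by
    apply hroot0
    rw [← ht.lie_e_f, ← add_neg_cancel (α : H → ℂ)]
    exact lie_mem_genWeightSpace_of_mem_genWeightSpace he hf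
  have hhh := hsl2 h e f ht
  have hef : ∀ t, Φ h t = Φ f ⁅t, e⁆ := fun t => by
    have := hinv e f t
    rw [ht.lie_e_f, ← lie_skew e t, map_neg] at this
    linear_combination this
  have hfe : Φ f e = 0 := by
    have := hef h
    rw [ht.lie_h_e_nsmul, hhh] at this
    simpa using this.symm
  have hh0 : ∀ t, Φ h t = 0 := by
    intro t
    have htm : t ∈ ⨆ χ : Weight ℂ H S, genWeightSpace S (χ : H → ℂ) :=
      htop ▸ LieSubmodule.mem_top t
    induction htm using LieSubmodule.iSup_induction' with
    | mem β t ht =>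
      by_cases hβ : (β : H → ℂ) = 0
      · rw [hβ] at ht
        have := IsKilling.lie_eq_smul_of_mem_rootSpace he ⟨t, hroot0 t ht⟩
        have h2 : ⁅t, e⁆ = α ⟨t, hroot0 t ht⟩ • e := this
        rw [hef, h2, map_smul, hfe, smul_zero]
      · obtain ⟨k, hk⟩ := Function.ne_iff.mp hβ
        have h1 : ⁅(k : S), t⁆ = β k • t := IsKilling.lie_eq_smul_of_mem_rootSpace ht k
        have h2 : ⁅(k : S), h⁆ = 0 := congrArg Subtype.val (trivial_lie_zero H H k ⟨h, hhH⟩)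
        have h3 := hinv k h t
        rw [h1, h2, map_zero, map_smul, LinearMap.zero_apply, zero_add] at h3
        exact (smul_eq_zero.mp h3).resolve_left hk
    | zero => exact map_zero _
    | add a b _ _ ha hb => rw [map_add, ha, hb, add_zero]
  let K : LieIdeal ℂ S :=
    { LinearMap.ker Φ with
      lie_mem := fun {a b} hb => by
        refine LinearMap.mem_ker.mpr (LinearMap.ext fun c => ?_)
        have h1 := hinv a b c
        have hb' : Φ b = 0 := hb
        rw [hb'] at h1
        simpa using h1 }
  have hK : h ∈ K := LinearMap.mem_ker.mpr (LinearMap.ext hh0)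
  rcases IsSimple.eq_bot_or_eq_top (R := ℂ) K with h0 | h0
  · rw [h0] at hK
    exact absurd hK ht.h_ne_zero
  · refine LinearMap.ext fun a => ?_
    have : a ∈ K := h0 ▸ LieSubmodule.mem_top a
    exact this

end

/-- If the symmetrisation of a Leibniz cocycle is killed by the kernel of a surjection onto a
simple Lie algebra, then it is zero. -/
theorem IsLeibnizCocycle.add_flip_eq_zero {L S : Type*} [LieRing L] [LieAlgebra ℂ L]
    [FiniteDimensional ℂ L] [LieRing S] [LieAlgebra ℂ S] [FiniteDimensional ℂ S]
    [LieAlgebra.IsSimple ℂ S] {f : L →ₗ[ℂ] L →ₗ[ℂ] ℂ} (hf : IsLeibnizCocycle f)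
    (π : L →ₗ⁅ℂ⁆ S) (hπ : Function.Surjective π)
    (hker : ∀ n, π n = 0 → ∀ a, f n a + f a n = 0) (a b : L) : f a b + f b a = 0 := by
  obtain ⟨σ, hσ⟩ := (π : L →ₗ[ℂ] S).exists_rightInverse_of_surjective
    (LinearMap.range_eq_top.mpr hπ)
  have hσ' : ∀ s, π (σ s) = s := fun s => LinearMap.congr_fun hσ s
  let ψ := f + f.flip
  have hψ : ∀ a b, ψ a b = f a b + f b a := fun a b => rfl
  have hψker : ∀ a a' b b', π a = π a' → π b = π b' → ψ a b = ψ a' b' := by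
    intro a a' b b' ha hb
    have h1 := hker (a - a') (by rw [map_sub, ha, sub_self]) b
    have h2 := hker (b - b') (by rw [map_sub, hb, sub_self]) a'
    simp only [map_sub, LinearMap.sub_apply] at h1 h2
    rw [hψ, hψ]
    linear_combination h1 + h2
  let Φ : S →ₗ[ℂ] S →ₗ[ℂ] ℂ := ψ.compl₁₂ σ σ
  have hΦ : ∀ a b, Φ (π a) (π b) = ψ a b := fun a b => hψker _ _ _ _ (hσ' _) (hσ' _)
  have h0 : Φ = 0 := by
    apply eq_zero_of_invariant_of_isSl2Triple
    · intro s t u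
      obtain ⟨a, rfl⟩ := hπ s
      obtain ⟨b, rfl⟩ := hπ t
      obtain ⟨c, rfl⟩ := hπ u
      rw [← LieHom.map_lie, ← LieHom.map_lie, hΦ, hΦ, hψ, hψ]
      exact hf.symm_invariant a b c
    · intro s t u h
      obtain ⟨x, rfl⟩ := hπ s
      obtain ⟨e, rfl⟩ := hπ t
      obtain ⟨y, rfl⟩ := hπ u
      have := vanishesOnSl2 L f hf π.ker (fun n hn a => hker n (LieHom.mem_ker.mp hn) a) x e y
        (by rw [LieHom.mem_ker, map_sub, LieHom.map_lie, map_smul, h.lie_h_e_nsmul,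
              two_smul, two_smul, sub_self])
        (by rw [LieHom.mem_ker, map_add, LieHom.map_lie, map_smul, h.lie_h_f_nsmul,
              two_smul, two_smul, neg_add_cancel])
        (by rw [LieHom.mem_ker, map_sub, LieHom.map_lie, h.lie_e_f, sub_self])
      rw [hΦ, hψ, this, add_zero]
  rw [← hψ, ← hΦ, h0]
  rfl

/-- The orthogonal of `B` with respect to the symmetrisations of a family of cocycles is contained
in `B`, provided that `B` contains every ideal whose derived ideal is in the radical of the
family. -/
theorem mem_of_forall_symm_cocycle_eq_zero {L ι : Type*} [LieRing L] [LieAlgebra ℂ L]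
    [FiniteDimensional ℂ L] (f : ι → L →ₗ[ℂ] L →ₗ[ℂ] ℂ) (hf : ∀ i, IsLeibnizCocycle (f i))
    (B : LieIdeal ℂ L) [LieAlgebra.HasTrivialRadical ℂ (L ⧸ B)]
    (hrad : ∀ x, (∀ i a, f i x a + f i a x = 0) → x ∈ B)
    (hmax : ∀ D : LieIdeal ℂ L, (∀ x, (∀ i a, f i x a + f i a x = 0) → x ∈ D) →
      (∀ a ∈ D, ∀ b ∈ D, ∀ i c, f i ⁅a, b⁆ c + f i c ⁅a, b⁆ = 0) → D ≤ B)
    {x : L} (hx : ∀ i, ∀ b ∈ B, f i x b + f i b x = 0) : x ∈ B := by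
  let I : LieIdeal ℂ L :=
    { carrier := {x | ∀ i, ∀ b ∈ B, f i x b + f i b x = 0}
      zero_mem' := fun i b _ => by simp
      add_mem' := fun {a b} ha hb i c hc => by
        have h1 := ha i c hc
        have h2 := hb i c hc
        simp only [map_add, LinearMap.add_apply]
        linear_combination h1 + h2
      smul_mem' := fun k a ha i c hc => by
        have h1 := ha i c hc
        simp only [map_smul, LinearMap.smul_apply, smul_eq_mul]
        linear_combination k * h1
      lie_mem := fun {a y} hy i b hb => by
        have h1 := (hf i).symm_invariant a y b
        have h2 := hy i _ (lie_mem_right ℂ L B a b hb)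
        linear_combination h1 - h2 }
  let π : L →ₗ⁅ℂ⁆ L ⧸ B :=
    { (LieSubmodule.Quotient.mk' B : L →ₗ[ℂ] L ⧸ B) with map_lie' := fun {_ _} => rfl }
  have hπ : Function.Surjective π := LieSubmodule.Quotient.surjective_mk' B
  have hπB : ∀ a, π a = 0 ↔ a ∈ B := fun a => LieSubmodule.Quotient.mk_eq_zero' (N := B)
  by_contra hxB
  have hJ : I.map π ≠ ⊥ := fun h0 => hxB <| by
    have hxI : x ∈ I := hx
    have := LieIdeal.mem_map (f := π) hxI
    rw [h0, LieSubmodule.mem_bot] at this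
    exact (hπB x).mp this
  obtain ⟨A, hA, hAJ⟩ := (eq_bot_or_exists_atom_le (I.map π)).resolve_left hJ
  have hsimple := LieAlgebra.IsSemisimple.isSimple_of_isAtom A hA
  let D : LieIdeal ℂ L := A.comap π ⊓ I
  have hD : ∀ a, a ∈ D ↔ π a ∈ A ∧ a ∈ I := fun a => by
    rw [LieSubmodule.mem_inf, LieIdeal.mem_comap]
  let ρ : D →ₗ⁅ℂ⁆ A :=
    { toFun := fun a => ⟨π a, ((hD a).mp a.2).1⟩
      map_add' := fun a b => rfl
      map_smul' := fun c a => rfl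
      map_lie' := fun {a b} => rfl }
  have hρ : Function.Surjective ρ := by
    rintro ⟨s, hs⟩
    obtain ⟨⟨a, ha⟩, rfl⟩ := LieIdeal.mem_map_of_surjective hπ (hAJ hs)
    exact ⟨⟨a, (hD a).mpr ⟨hs, ha⟩⟩, rfl⟩
  have hDD : ∀ i, ∀ a ∈ D, ∀ b ∈ D, f i a b + f i b a = 0 := fun i a ha b hb =>
    ((hf i).comp D.incl).add_flip_eq_zero ρ hρ (fun n hn c => by
      have hnB : (n : L) ∈ B := (hπB n).mp (congrArg Subtype.val hn)
      have := ((hD c).mp c.2).2 i n hnB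
      change f i n c + f i c n = 0
      rwa [add_comm]) ⟨a, ha⟩ ⟨b, hb⟩
  have hle : D ≤ B := by
    refine hmax D (fun y hy => (hD y).mpr ⟨?_, fun i b _ => hy i b⟩) fun a ha b hb i c => ?_
    · rw [(hπB y).mpr (hrad y hy)]
      exact A.zero_mem
    · have h1 := (hf i).symm_invariant a b c
      rwa [hDD i b hb _ (lie_mem_left ℂ L D a c ha), add_zero] at h1
  refine hA.1 ((LieSubmodule.eq_bot_iff A).mpr fun s hs => ?_)
  obtain ⟨⟨a, ha⟩, h⟩ := hρ ⟨s, hs⟩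
  exact (congrArg Subtype.val h).symm.trans ((hπB a).mpr (hle ha))

section

variable {M : Type*} [AddCommGroup M] [Module ℂ M] {br : M →ₗ[ℂ] M →ₗ[ℂ] M}

theorem IsLeftLeibniz.bracket_eq_zero_of_mem_leibnizKernel (hleib : IsLeftLeibniz br) {c : M}
    (hc : c ∈ leibnizKernel br) : br c = 0 := by
  have : leibnizKernel br ≤ LinearMap.ker br := by
    refine Submodule.span_le.mpr ?_
    rintro _ ⟨a, rfl⟩
    refine LinearMap.mem_ker.mpr (LinearMap.ext fun b => ?_)
    simpa using hleib a a b
  exact this hc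

theorem IsLeftCentral.bracket_eq_zero_of_mem_leibnizKernel (hcent : IsLeftCentral br) {c : M}
    (hc : c ∈ leibnizKernel br) (a : M) : br a c = 0 := by
  have : leibnizKernel br ≤ LinearMap.ker (br a) := by
    refine Submodule.span_le.mpr ?_
    rintro _ ⟨b, rfl⟩
    exact hcent a b
  exact this hc

theorem derivedSeriesMod_succ_le {R U V : Submodule ℂ M}
    (h : derivedSeriesMod br R U 1 ≤ derivedSeriesMod br R V 0) (n : ℕ) :
    derivedSeriesMod br R U (n + 1) ≤ derivedSeriesMod br R V n := by
  induction n with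
  | zero => exact h
  | succ n ih =>
    refine sup_le_sup_right (Submodule.span_mono ?_) R
    rintro _ ⟨a, ha, b, hb, rfl⟩
    exact ⟨a, ih ha, b, ih hb, rfl⟩

end

/-- (Lemma 4.7)  If `B/R` is the solvable radical of `M/R` then
`B^⊥ ⊆ B`. -/
theorem perp_of_solvable_radical (M : Type*) [AddCommGroup M] [Module ℂ M]
    [FiniteDimensional ℂ M] (br : M →ₗ[ℂ] M →ₗ[ℂ] M) (hleib : IsLeftLeibniz br)
    (hcent : IsLeftCentral br)
    (R : Submodule ℂ M) (hR : ∀ x : M, x ∈ R ↔ ∀ a : M, br x a + br a x = 0)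
    (B : Submodule ℂ M) (hRB : R ≤ B) (hB : IsSolvableRadicalMod br R B) :
    ∀ x : M, (∀ b ∈ B, br x b + br b x = 0) → x ∈ B := by
  obtain ⟨⟨-, hBideal⟩, ⟨n, hn⟩, hBmax⟩ := hB
  let C := leibnizKernel br
  have hC1 : ∀ c ∈ C, ∀ a, br c a = 0 := fun c hc a => by
    rw [hleib.bracket_eq_zero_of_mem_leibnizKernel hc, LinearMap.zero_apply]
  have hC2 : ∀ c ∈ C, ∀ a, br a c = 0 := fun c hc a =>
    hcent.bracket_eq_zero_of_mem_leibnizKernel hc a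
  have hCR : C ≤ R := fun c hc => (hR c).mpr fun a => by rw [hC1 c hc, hC2 c hc, add_zero]
  obtain ⟨brC, hbrC⟩ := exists_lift_quotient C (br.compr₂ C.mkQ) (fun c hc a => by simp [hC1 c hc])
    (fun c hc a => by simp [hC2 c hc])
  have hsurj := C.mkQ_surjective
  let _ : LieRing (M ⧸ C) :=
    { bracket := fun a b => brC a b
      add_lie := fun a b c => by simp
      lie_add := fun a b c => by simp
      lie_self := fun a => by
        obtain ⟨a, rfl⟩ := hsurj a
        change brC _ _ = 0
        rw [hbrC]
        exact (Submodule.Quotient.mk_eq_zero C).mpr (Submodule.subset_span ⟨a, rfl⟩)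
      leibniz_lie := fun a b c => by
        obtain ⟨a, rfl⟩ := hsurj a
        obtain ⟨b, rfl⟩ := hsurj b
        obtain ⟨c, rfl⟩ := hsurj c
        change brC _ (brC _ _) = brC (brC _ _) _ + brC _ (brC _ _)
        simp only [hbrC, LinearMap.compr₂_apply]
        rw [hleib, map_add] }
  let _ : LieAlgebra ℂ (M ⧸ C) := { lie_smul := fun t a b => map_smul (brC a) t b }
  have hlie : ∀ a b, ⁅C.mkQ a, C.mkQ b⁆ = C.mkQ (br a b) := hbrC
  have hφ : ∀ φ : Module.Dual ℂ M, ∃ f : (M ⧸ C) →ₗ[ℂ] (M ⧸ C) →ₗ[ℂ] ℂ,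
      ∀ a b, f (C.mkQ a) (C.mkQ b) = φ (br a b) := fun φ =>
    exists_lift_quotient C (br.compr₂ φ) (fun c hc a => by simp [hC1 c hc])
      (fun c hc a => by simp [hC2 c hc])
  choose f hf using hφ
  have hcoc : ∀ φ, IsLeibnizCocycle (f φ) := fun φ a b c => by
    obtain ⟨a, rfl⟩ := hsurj a
    obtain ⟨b, rfl⟩ := hsurj b
    obtain ⟨c, rfl⟩ := hsurj c
    simp only [hlie, hf]
    rw [hleib, map_add]
  have hpsi : ∀ a b, (∀ φ, f φ (C.mkQ a) (C.mkQ b) + f φ (C.mkQ b) (C.mkQ a) = 0) ↔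
      br a b + br b a = 0 := fun a b => by
    simp only [hf, ← map_add]
    exact Module.forall_dual_apply_eq_zero_iff ℂ _
  have hrad : ∀ y, (∀ φ a, f φ (C.mkQ y) a + f φ a (C.mkQ y) = 0) ↔ y ∈ R := fun y => by
    rw [hR]
    refine ⟨fun h a => (hpsi y a).mp fun φ => h φ _, fun h φ a => ?_⟩
    obtain ⟨a, rfl⟩ := hsurj a
    exact (hpsi y a).mpr (h a) φ
  let B' : LieIdeal ℂ (M ⧸ C) :=
    { B.map C.mkQ with
      lie_mem := by
        rintro a _ ⟨b, hb, rfl⟩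
        obtain ⟨a, rfl⟩ := hsurj a
        exact ⟨br a b, (hBideal a b hb).1, (hlie a b).symm⟩ }
  have hB' : ∀ a, C.mkQ a ∈ B' ↔ a ∈ B := fun a => by
    refine ⟨?_, fun h => ⟨a, h, rfl⟩⟩
    rintro ⟨b, hb, h⟩
    rw [← sub_add_cancel a b]
    exact B.add_mem (hRB (hCR ((Submodule.Quotient.eq C).mp h.symm))) hb
  have : LieAlgebra.HasTrivialRadical ℂ ((M ⧸ C) ⧸ B') := by
    rw [LieAlgebra.hasTrivialRadical_iff_no_abelian_ideals]
    intro J hJ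
    let π : (M ⧸ C) →ₗ⁅ℂ⁆ (M ⧸ C) ⧸ B' :=
      { (LieSubmodule.Quotient.mk' B' : (M ⧸ C) →ₗ[ℂ] (M ⧸ C) ⧸ B') with
        map_lie' := fun {_ _} => rfl }
    have hπ : Function.Surjective π := LieSubmodule.Quotient.surjective_mk' B'
    have hπB : ∀ a, π (C.mkQ a) = 0 ↔ a ∈ B := fun a =>
      (LieSubmodule.Quotient.mk_eq_zero' (N := B')).trans (hB' a)
    let U : Submodule ℂ M := J.toSubmodule.comap ((π : (M ⧸ C) →ₗ[ℂ] (M ⧸ C) ⧸ B').comp C.mkQ)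
    have hU : ∀ a, a ∈ U ↔ π (C.mkQ a) ∈ J := fun a => Iff.rfl
    have hbr : ∀ a b, π (C.mkQ (br a b)) = ⁅π (C.mkQ a), π (C.mkQ b)⁆ := fun a b => by
      rw [← hlie, LieHom.map_lie]
    have hRU : R ≤ U := fun r hr => by
      rw [hU, (hπB r).mpr (hRB hr)]
      exact J.zero_mem
    have hUB : U ≤ B := by
      refine hBmax U ⟨hRU, fun m a ha => ⟨?_, ?_⟩⟩ ⟨n + 1, (derivedSeriesMod_succ_le ?_ n).trans hn⟩
      · rw [hU, hbr]
        exact lie_mem_right ℂ _ J _ _ ha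
      · rw [hU, hbr]
        exact lie_mem_left ℂ _ J _ _ ha
      · refine sup_le_sup_right (Submodule.span_le.mpr ?_) R
        rintro _ ⟨a, ha, b, hb, rfl⟩
        have ha : a ∈ U := sup_le le_rfl hRU ha
        have hb : b ∈ U := sup_le le_rfl hRU hb
        refine (hπB _).mp ?_
        rw [hbr]
        exact congrArg Subtype.val (hJ.trivial ⟨_, ha⟩ ⟨_, hb⟩)
    refine (LieSubmodule.eq_bot_iff J).mpr fun s hs => ?_
    obtain ⟨a, rfl⟩ := hπ s
    obtain ⟨a, rfl⟩ := hsurj a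
    exact (hπB a).mpr (hUB hs)
  intro x hx
  rw [← hB']
  refine mem_of_forall_symm_cocycle_eq_zero f hcoc B' (fun y hy => ?_) (fun D hRD hD => ?_)
    (fun φ b hb => ?_)
  · obtain ⟨y, rfl⟩ := hsurj y
    exact (hB' y).mpr (hRB ((hrad y).mp hy))
  · let U : Submodule ℂ M := D.toSubmodule.comap C.mkQ
    have hU : ∀ a, a ∈ U ↔ C.mkQ a ∈ D := fun a => Iff.rfl
    have hRU : R ≤ U := fun r hr => hRD _ ((hrad r).mpr hr)
    have hUB : U ≤ B := by
      refine hBmax U ⟨hRU, fun m a ha => ⟨?_, ?_⟩⟩ ⟨1, ?_⟩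
      · rw [hU, ← hlie]
        exact lie_mem_right ℂ _ D _ _ ha
      · rw [hU, ← hlie]
        exact lie_mem_left ℂ _ D _ _ ha
      · refine sup_le (Submodule.span_le.mpr ?_) le_rfl
        rintro _ ⟨a, ha, b, hb, rfl⟩
        have ha : a ∈ U := sup_le le_rfl hRU ha
        have hb : b ∈ U := sup_le le_rfl hRU hb
        refine (hrad _).mp fun φ c => ?_
        rw [← hlie]
        exact hD _ ha _ hb φ c
    intro d hd
    obtain ⟨a, rfl⟩ := hsurj d
    exact (hB' a).mpr (hUB hd)
  · obtain ⟨b, rfl⟩ := hsurj b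
    exact (hpsi x b).mpr (hx b ((hB' b).mp hb)) φ
end

section
/- Let L₁ and L₂ be finite-dimensional complex Lie algebras with a common ideal R such that L₂/R is abelian, and set Z := R ∩ Z(L₁) ∩ Z(L₂). Let α : L₁ → Der(L₂) be a morphism of Lie algebras, written α(x)(y) = x·y, such that x·y = [x,y] whenever x ∈ R or y ∈ R. Let ψ' : L₁ × L₂ → Z be a bilinear map satisfying ψ'([x₁,x₂],y) = ψ'(x₁, x₂·y) for all x₁,x₂ ∈ L₁, y ∈ L₂, and such that R = {x ∈ L₁ : ψ'(x,y) = 0 for all y ∈ L₂} = {y ∈ L₂ : ψ'(x,y) = 0 for all x ∈ L₁}. Then M := L₁ ⊕ L₂ with bracket [(x₁,y₁),(x₂,y₂)] := ([x₁,x₂], x₁·y₂ − x₂·y₁ + [y₁,y₂] + ψ'(x₂,y₁)) is a left central Leibniz algebra, {0} ⊕ L₂ is a two-sided ideal of M, and the radical of ψ_M equals R ⊕ R. -/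
open Submodule

/-- (Lemma 4.8, first part)  The construction `M = L₁ ⊕ L₂` from
Lie-theoretic data `(L₁, L₂, R, α, ψ')` is a left central Leibniz algebra, `{0} ⊕ L₂` is
a two-sided ideal, and the radical of `ψ_M` is `R ⊕ R`. -/
theorem construction_left_central (R L₁ L₂ : Type*)
    [LieRing R] [LieAlgebra ℂ R] [FiniteDimensional ℂ R]
    [LieRing L₁] [LieAlgebra ℂ L₁] [FiniteDimensional ℂ L₁]
    [LieRing L₂] [LieAlgebra ℂ L₂] [FiniteDimensional ℂ L₂]
    (f₁ : R →ₗ⁅ℂ⁆ L₁) (f₂ : R →ₗ⁅ℂ⁆ L₂)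
    (hf₁ : Function.Injective f₁) (hf₂ : Function.Injective f₂)
    (hf₁ideal : ∀ (x : L₁) (r : R), ⁅x, f₁ r⁆ ∈ LinearMap.range (f₁ : R →ₗ[ℂ] L₁))
    (hf₂ideal : ∀ (y : L₂) (r : R), ⁅y, f₂ r⁆ ∈ LinearMap.range (f₂ : R →ₗ[ℂ] L₂))
    (habelian : ∀ y₁ y₂ : L₂, ⁅y₁, y₂⁆ ∈ LinearMap.range (f₂ : R →ₗ[ℂ] L₂))
    (α : L₁ →ₗ[ℂ] L₂ →ₗ[ℂ] L₂)
    (hα₁ : ∀ (x₁ x₂ : L₁) (y : L₂), α ⁅x₁, x₂⁆ y = α x₁ (α x₂ y) - α x₂ (α x₁ y))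
    (hα₂ : ∀ (x : L₁) (y₁ y₂ : L₂), α x ⁅y₁, y₂⁆ = ⁅α x y₁, y₂⁆ + ⁅y₁, α x y₂⁆)
    (hα₃ : ∀ (r : R) (y : L₂), α (f₁ r) y = ⁅f₂ r, y⁆)
    (hα₄ : ∀ (x : L₁) (r r' : R), f₁ r' = ⁅x, f₁ r⁆ → α x (f₂ r) = f₂ r')
    (ψ' : L₁ →ₗ[ℂ] L₂ →ₗ[ℂ] R)
    (hZ : ∀ (x : L₁) (y : L₂),
      (∀ w : L₁, ⁅f₁ (ψ' x y), w⁆ = 0) ∧ (∀ w : L₂, ⁅f₂ (ψ' x y), w⁆ = 0))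
    (hassoc : ∀ (x₁ x₂ : L₁) (y : L₂), ψ' ⁅x₁, x₂⁆ y = ψ' x₁ (α x₂ y))
    (hrad₁ : ∀ x : L₁, (∀ y : L₂, ψ' x y = 0) ↔ x ∈ LinearMap.range (f₁ : R →ₗ[ℂ] L₁))
    (hrad₂ : ∀ y : L₂, (∀ x : L₁, ψ' x y = 0) ↔ y ∈ LinearMap.range (f₂ : R →ₗ[ℂ] L₂))
    (br : (L₁ × L₂) →ₗ[ℂ] (L₁ × L₂) →ₗ[ℂ] (L₁ × L₂))
    (hbr : ∀ p q : L₁ × L₂,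
      br p q = (⁅p.1, q.1⁆, α p.1 q.2 - α q.1 p.2 + ⁅p.2, q.2⁆ + f₂ (ψ' q.1 p.2))) :
    IsLeftLeibniz br ∧ IsLeftCentral br ∧
    IsTwoSidedIdeal br (Submodule.prod (⊥ : Submodule ℂ L₁) (⊤ : Submodule ℂ L₂)) ∧
    (∀ p : L₁ × L₂, (∀ q : L₁ × L₂, br p q + br q p = 0) ↔
      p ∈ Submodule.prod (LinearMap.range (f₁ : R →ₗ[ℂ] L₁))
            (LinearMap.range (f₂ : R →ₗ[ℂ] L₂))) := by
  have α_center (x : L₁) (x' : L₁) (y : L₂) : α x (f₂ (ψ' x' y)) = 0 := by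
    have h := (hZ x' y).1 x
    rw [← lie_skew, neg_eq_zero] at h
    rw [hα₄ x _ 0 (by rw [h, map_zero]), map_zero]
  have center_lie (x : L₁) (y w : L₂) : ⁅f₂ (ψ' x y), w⁆ = 0 := (hZ x y).2 w
  have lie_center (x : L₁) (y w : L₂) : ⁅w, f₂ (ψ' x y)⁆ = 0 := by
    rw [← lie_skew, center_lie, neg_zero]
  have ψ_lie (x : L₁) (y₁ y₂ : L₂) : ψ' x ⁅y₁, y₂⁆ = 0 := (hrad₂ _).2 (habelian y₁ y₂) x
  have ψ_center (x x' : L₁) (y : L₂) : ψ' x (f₂ (ψ' x' y)) = 0 := (hrad₂ _).2 ⟨_, rfl⟩ x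
  have add_swap (p q : L₁ × L₂) :
      br p q + br q p = (0, f₂ (ψ' q.1 p.2 + ψ' p.1 q.2)) := by
    rw [hbr, hbr, ← lie_skew p.1, ← lie_skew p.2, map_add]
    ext
    · exact neg_add_cancel _
    · simp only [Prod.snd_add]
      abel
  refine ⟨?_, ?_, ?_, ?_⟩
  · rintro ⟨x₁, y₁⟩ ⟨x₂, y₂⟩ ⟨x₃, y₃⟩
    have ψ_skew : ψ' ⁅x₁, x₃⁆ y₂ = -ψ' x₃ (α x₁ y₂) := by
      rw [← hassoc, ← lie_skew, map_neg, LinearMap.neg_apply]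
    have ψ_skew' : ψ' ⁅x₂, x₃⁆ y₁ = -ψ' x₃ (α x₂ y₁) := by
      rw [← hassoc, ← lie_skew, map_neg, LinearMap.neg_apply]
    simp only [hbr]
    ext
    · simp
    · simp only [Prod.snd_add, map_add, map_sub, map_neg, lie_add, lie_sub, add_lie, sub_lie,
        α_center, center_lie, lie_center, ψ_lie, ψ_center, hα₁, hα₂, ψ_skew, ψ_skew', map_zero]
      rw [leibniz_lie y₁ y₂ y₃, ← lie_skew (α x₃ y₁) y₂]
      abel
  · rintro ⟨x₁, y₁⟩ ⟨x₂, y₂⟩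
    simp [hbr, α_center, lie_center]
  · rintro ⟨x₁, y₁⟩ ⟨x₂, y₂⟩ h
    obtain rfl : x₂ = 0 := h.1
    simp [hbr, Submodule.mem_prod]
  · rintro ⟨x, y⟩
    rw [Submodule.mem_prod, ← hrad₁, ← hrad₂]
    simp only [add_swap, Prod.mk_eq_zero, true_and, map_eq_zero_iff f₂ hf₂]
    refine ⟨fun h => ⟨fun w => ?_, fun w => ?_⟩, fun h q => ?_⟩
    · simpa using h (0, w)
    · simpa using h (w, 0)
    · rw [h.1, h.2, add_zero]
end
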